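/- Let δ₀, c₆ > 0 be absolute constants and, for 2 ≤ y ≤ x, let β : [−c₆√ū, c₆√ū] → (0,1] be differentiable with β(0) = α, and such that for each v ∈ [0, c₆√ū], (β(v),β(−v)) ∈ D_{δ₀}(α;y), ∂₁₀f_y(β(v),β(−v)) = vϱ − (log x)/2 and ∂₀₁f_y(β(v),β(−v)) = −vϱ − (log x)/2. Define E(v) := f_y(β(v),β(−v)) + ((β(v)+β(−v))/2)·log x − vϱ·(β(v)−β(−v)). Then there exist a sequence of real numbers (b_j(x,y))_{j ≥ 0} with b₀(x,y) = −1/2 and, for each j ≥ 1, |b_j(x,y)| ≤ C_j ū^{−j} with C_j absolute, and for each integer k ≥ 1 a constant C'_k such that for all v ∈ [−c₆√ū, c₆√ū]: |E(v) − E(0) − ∑_{j=0}^{k−1} b_j(x,y) v^{2j+2}| ≤ C'_k v^{2k+2}/ū^k; moreover there is an absolute constant C with |Hess[f_y](β(v),β(−v)) − Hess[f_y](α,α)| ≤ C (v²/ū) · Hess[f_y](α,α). -/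

import Mathlib

open Complex Finset MeasureTheory
open scoped Real Classical

noncomputable section

/-- The set of primes `p ≤ y`. -/
def primesLe (y : ℝ) : Finset ℕ := (Finset.Iic ⌊y⌋₊).filter Nat.Prime

/-- `α` satisfies the saddle-point equation `∑_{p ≤ y} log p/(p^α − 1) = log x`. -/
def saddleEq (x y α : ℝ) : Prop :=
  ∑ p ∈ primesLe y, Real.log p / ((p : ℝ) ^ α - 1) = Real.log x

/-- `ū = min{u, π(y)}` where `u = log x/log y`. -/
def ubar (x y : ℝ) : ℝ := min (Real.log x / Real.log y) ((primesLe y).card)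

def sigma2 (y α : ℝ) : ℝ :=
  ∑ p ∈ primesLe y, (Real.log p) ^ 2 * (p : ℝ) ^ α / ((p : ℝ) ^ α - 1) ^ 2

def sigma2t (y α : ℝ) : ℝ :=
  ∑ p ∈ primesLe y, (Real.log p) ^ 2 / ((p : ℝ) ^ α - 1) ^ 2

/-- `ϱ = (1/2)(σ₂ − σ̃₂/3)^{1/2}`. -/
def rhoXY (y α : ℝ) : ℝ := (1 / 2) * Real.sqrt (sigma2 y α - sigma2t y α / 3)

/-- `n` is `y`-friable: every prime factor of `n` is at most `y`. -/
def friable (y : ℝ) (n : ℕ) : Prop := ∀ p : ℕ, p.Prime → p ∣ n → (p : ℝ) ≤ y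

/-- `S(x,y)`: the set of `y`-friable integers `1 ≤ n ≤ x`. -/
def Sxy (x y : ℝ) : Finset ℕ := (Finset.Icc 1 ⌊x⌋₊).filter (friable y)

/-- `Ψ(x,y) = #S(x,y)`. -/
def Psi (x y : ℝ) : ℕ := (Sxy x y).card

/-- `D(x,y;γ) = Ψ(x,y)⁻¹ ∑_{n ∈ S(x,y)} τ(n)⁻¹ #{d ∣ n : d ≥ √n e^γ}`. -/
def Dxy (x y γ : ℝ) : ℝ :=
  (Psi x y : ℝ)⁻¹ * ∑ n ∈ Sxy x y,
    ((n.divisors.card : ℝ))⁻¹ *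
      ((n.divisors.filter (fun d => Real.sqrt n * Real.exp γ ≤ (d : ℝ))).card : ℝ)

/-- `Φ(v) = ∫_v^∞ e^{-z²/2} dz/√(2π)`. -/
def PhiGauss (v : ℝ) : ℝ :=
  ∫ z in Set.Ioi v, Real.exp (-z ^ 2 / 2) / Real.sqrt (2 * Real.pi)

/-- `g(z) = log((z^{1/2} − z^{-1/2})/log z)`, with `g(1) = 0`. -/
def gfun (z : ℂ) : ℂ :=
  if z = 1 then 0
  else Complex.log ((z ^ (2⁻¹ : ℂ) - z ^ (-2⁻¹ : ℂ)) / Complex.log z)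

/-- `Ξ(a,b) = −(1/2)log(1−a) − (1/2)log(1−b) − g((1−a)/(1−b))`. -/
def Xi (a b : ℂ) : ℂ :=
  -(2⁻¹ : ℂ) * Complex.log (1 - a) - (2⁻¹ : ℂ) * Complex.log (1 - b) -
    gfun ((1 - a) / (1 - b))

/-- `f_y(s,w) = ∑_{p ≤ y} Ξ(p^{-s}, p^{-w})`. -/
def fy (y : ℝ) (s w : ℂ) : ℂ := ∑ p ∈ primesLe y, Xi ((p : ℂ) ^ (-s)) ((p : ℂ) ^ (-w))

/-- `F_y(s,w) = exp(f_y(s,w))`. -/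
def Fy (y : ℝ) (s w : ℂ) : ℂ := Complex.exp (fy y s w)

/-- `F_y(σ,κ)` at real arguments, as a (positive) real number. -/
def FyR (y σ κ : ℝ) : ℝ := Real.exp ((fy y (σ : ℂ) (κ : ℂ)).re)

/-- `∂_{kℓ}f(s,w)`: partial derivative `k` times in the first variable and `ℓ` times
in the second. -/
def pdv (k l : ℕ) (f : ℂ → ℂ → ℂ) (s w : ℂ) : ℂ :=
  iteratedDeriv k (fun z => iteratedDeriv l (f z) w) s

/-- `Hess[f_y] = (∂₂₀f_y)(∂₀₂f_y) − (∂₁₁f_y)²`. -/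
def HessC (y : ℝ) (s w : ℂ) : ℂ :=
  pdv 2 0 (fy y) s w * pdv 0 2 (fy y) s w - (pdv 1 1 (fy y) s w) ^ 2

/-- The domain `D_δ(α;y)`. -/
def Ddom (δ α y : ℝ) : Set (ℝ × ℝ) :=
  {p | 0 < p.1 ∧ p.1 ≤ 1 ∧ 0 < p.2 ∧ p.2 ≤ 1 ∧ 0 ≤ (p.1 - α) * (α - p.2) ∧
    1 / (1 + δ) ≤ (1 - (2 : ℝ) ^ (-p.1)) / (1 - (2 : ℝ) ^ (-p.2)) ∧
    (1 - (2 : ℝ) ^ (-p.1)) / (1 - (2 : ℝ) ^ (-p.2)) ≤ 1 + δ ∧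
    |p.1 - p.2| * Real.log y ≤ δ}

/-- `φ_k(s,y)`: the `k`-th derivative in `s` of `φ₀(s,y) = −∑_{p ≤ y} log(1−p^{-s})`. -/
def phiD (y : ℝ) (k : ℕ) (s : ℂ) : ℂ :=
  iteratedDeriv k (fun z => -∑ p ∈ primesLe y, Complex.log (1 - (p : ℂ) ^ (-z))) s

/-- `φ₂(σ,y) = ∑_{p ≤ y} (log p)² p^σ/(p^σ−1)²` for real `σ`. -/
def phi2R (y σ : ℝ) : ℝ :=
  ∑ p ∈ primesLe y, (Real.log p) ^ 2 * (p : ℝ) ^ σ / ((p : ℝ) ^ σ - 1) ^ 2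


/-- `E(v) = f_y(β(v),β(−v)) + ((β(v)+β(−v))/2) log x − vϱ (β(v)−β(−v))`. -/
def Efun (x y α : ℝ) (β : ℝ → ℝ) (v : ℝ) : ℝ :=
  (fy y (β v : ℂ) (β (-v) : ℂ)).re + ((β v + β (-v)) / 2) * Real.log x -
    v * rhoXY y α * (β v - β (-v))

theorem mem_primesLe {y : ℝ} (hy : 0 ≤ y) {p : ℕ} :
    p ∈ primesLe y ↔ p.Prime ∧ (p : ℝ) ≤ y := by
  simp [primesLe, Nat.le_floor_iff hy, and_comm]

/-- `log n! = ∑_{p ≤ y} v_p(n!) log p` with `n = ⌊y⌋`. -/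
theorem log_factorial_eq_sum_primesLe (y : ℝ) :
    Real.log (⌊y⌋₊.factorial) =
      ∑ p ∈ primesLe y, (⌊y⌋₊.factorial.factorization p : ℝ) * Real.log p := by
  set n := ⌊y⌋₊
  have h : (n.factorial : ℝ) = ∏ p ∈ primesLe y, (p : ℝ) ^ (n.factorial.factorization p) := by
    conv_lhs => rw [← Nat.prod_factorization_pow_eq_self (Nat.factorial_ne_zero n)]
    rw [Finsupp.prod, Nat.cast_prod]
    rw [Finset.prod_subset (s₂ := primesLe y)]
    · simp
    · intro p hp
      have hp' := Nat.prime_of_mem_primeFactors hp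
      simp only [primesLe, mem_filter, mem_Iic]
      exact ⟨(hp'.dvd_factorial).1 (Nat.dvd_of_mem_primeFactors hp), hp'⟩
    · intro p _ hp
      rw [Finsupp.notMem_support_iff.1 hp]; simp
  rw [h, Real.log_prod]
  · simp
  · intro p hp
    have : p.Prime := (mem_filter.1 hp).2
    have := this.ne_zero
    positivity

theorem sum_log_div_pred_le {y : ℝ} (hy : 1 ≤ y) :
    ∑ p ∈ primesLe y, Real.log p / ((p : ℝ) - 1) ≤ 6 * Real.log y := by
  rcases lt_or_ge y 2 with h2 | h2
  · have : primesLe y = ∅ := by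
      ext p
      rw [mem_primesLe (by linarith)]
      simp only [notMem_empty, iff_false, not_and, not_le]
      intro hp
      have : (2 : ℝ) ≤ p := by exact_mod_cast hp.two_le
      linarith
    rw [this]
    simpa using Real.log_nonneg hy
  set n := ⌊y⌋₊ with hn
  have hn2 : 2 ≤ n := Nat.le_floor (by exact_mod_cast h2)
  have hn0 : (0 : ℝ) < n := by positivity
  have hny : (n : ℝ) ≤ y := Nat.floor_le (by linarith)
  have hlogn : Real.log n ≤ Real.log y := Real.log_le_log hn0 hny
  have hfac : Real.log n.factorial ≤ n * Real.log n := by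
    rw [← Real.log_pow]
    exact Real.log_le_log (by positivity) (by exact_mod_cast Nat.factorial_le_pow n)
  have htheta : ∑ p ∈ primesLe y, Real.log p ≤ Real.log 4 * n := by
    have h := Chebyshev.theta_le_log4_mul_x (x := n) hn0.le
    refine le_trans (le_of_eq ?_) h
    rw [Chebyshev.theta_eq_sum_Icc]
    simp only [Nat.floor_natCast, primesLe, ← hn]
    congr 1
  have hpt : ∀ p ∈ primesLe y, Real.log p / ((p : ℝ) - 1) ≤
      2 / n * (((n.factorial.factorization p : ℝ)) * Real.log p + Real.log p) := by
    intro p hp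
    have hpp := (mem_filter.1 hp).2
    have hp2 : (2 : ℝ) ≤ p := by exact_mod_cast hpp.two_le
    have hl : 0 ≤ Real.log p := Real.log_nonneg (by linarith)
    have hv : (n : ℝ) / p - 1 ≤ n.factorial.factorization p := by
      have h1 : n / p ≤ n.factorial.factorization p := by
        have h3 : p ^ (n / p) ∣ n.factorial := by
          calc p ^ (n / p) ∣ (p * (n / p)).factorial := by
                generalize n / p = k
                induction k with
                | zero => simp
                | succ k ih =>
                  rw [mul_add, mul_one, pow_succ]
                  refine (mul_dvd_mul ih (Nat.dvd_factorial hpp.pos le_rfl)).trans ?_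
                  exact Nat.factorial_mul_factorial_dvd_factorial_add _ _
            _ ∣ n.factorial := Nat.factorial_dvd_factorial (Nat.mul_div_le n p)
        exact (hpp.pow_dvd_iff_le_factorization (Nat.factorial_ne_zero n)).1 h3
      have h2 : (n : ℝ) / p < (n / p : ℕ) + 1 := by
        rw [div_lt_iff₀ (by linarith)]
        rw [mul_comm]
        exact_mod_cast Nat.lt_mul_div_succ n hpp.pos
      have h3 : ((n / p : ℕ) : ℝ) ≤ n.factorial.factorization p := by exact_mod_cast h1
      linarith
    have h4 : Real.log p / ((p : ℝ) - 1) ≤ 2 / n * (n / p * Real.log p) := by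
      have : 2 / (n : ℝ) * (n / p * Real.log p) = Real.log p / (p / 2) := by
        field_simp
      rw [this]
      exact div_le_div_of_nonneg_left hl (by linarith) (by linarith)
    refine h4.trans ?_
    have : (n : ℝ) / p * Real.log p ≤
        (n.factorial.factorization p : ℝ) * Real.log p + Real.log p := by nlinarith
    gcongr
  calc ∑ p ∈ primesLe y, Real.log p / ((p : ℝ) - 1)
      ≤ ∑ p ∈ primesLe y, 2 / n * (((n.factorial.factorization p : ℝ)) * Real.log p
          + Real.log p) := Finset.sum_le_sum hpt
    _ = 2 / n * (Real.log n.factorial + ∑ p ∈ primesLe y, Real.log p) := by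
        rw [← Finset.mul_sum, Finset.sum_add_distrib, log_factorial_eq_sum_primesLe]
    _ ≤ 2 / n * (n * Real.log n + Real.log 4 * n) := by gcongr
    _ = 2 * (Real.log n + Real.log 4) := by field_simp
    _ ≤ 6 * Real.log y := by
        have h4 : Real.log 4 = 2 * Real.log 2 := by
          rw [show (4 : ℝ) = 2 ^ 2 by norm_num, Real.log_pow]; norm_num
        have : Real.log 2 ≤ Real.log y := Real.log_le_log (by norm_num) h2
        linarith

theorem le_sum_log_div_pred {y : ℝ} (hy : 2 ≤ y) :
    Real.log y / 4 ≤ ∑ p ∈ primesLe y, Real.log p / ((p : ℝ) - 1) := by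
  set n := ⌊y⌋₊ with hn
  have hn2 : 2 ≤ n := Nat.le_floor (by exact_mod_cast hy)
  have hn2' : (2 : ℝ) ≤ n := by exact_mod_cast hn2
  have hn0 : (0 : ℝ) < n := by positivity
  have hyn : Real.log y ≤ Real.log n + Real.log 2 := by
    rw [← Real.log_mul (by positivity) (by norm_num)]
    refine Real.log_le_log (by linarith) ?_
    have := Nat.lt_floor_add_one y
    linarith
  have hlog2 : Real.log 2 ≤ Real.log n := Real.log_le_log (by norm_num) hn2'
  have hnonneg : ∀ p ∈ primesLe y, 0 ≤ Real.log p / ((p : ℝ) - 1) := by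
    intro p hp
    have hp1 : (1 : ℝ) ≤ p := by exact_mod_cast (mem_filter.1 hp).2.one_le
    exact div_nonneg (Real.log_nonneg hp1) (by linarith)
  have h2 : Real.log 2 ≤ ∑ p ∈ primesLe y, Real.log p / ((p : ℝ) - 1) := by
    refine le_trans (le_of_eq ?_) (Finset.single_le_sum hnonneg
      (a := 2) ((mem_primesLe (by linarith)).2 ⟨Nat.prime_two, by exact_mod_cast hy⟩))
    norm_num
  have hstir : Real.log n - 1 ≤ ∑ p ∈ primesLe y, Real.log p / ((p : ℝ) - 1) := by
    have h3 : n * Real.log n - n ≤ Real.log n.factorial := by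
      have := Stirling.le_log_factorial_stirling (n := n) (by omega)
      have h5 : 0 ≤ Real.log n := Real.log_nonneg (by linarith)
      have h6 : 0 ≤ Real.log (2 * π) := Real.log_nonneg (by linarith [Real.pi_gt_three])
      linarith
    have h4 : Real.log n.factorial ≤ n * ∑ p ∈ primesLe y, Real.log p / ((p : ℝ) - 1) := by
      rw [hn, log_factorial_eq_sum_primesLe, ← hn, Finset.mul_sum]
      refine Finset.sum_le_sum fun p hp => ?_
      have hpp := (mem_filter.1 hp).2
      have hp2 : (2 : ℝ) ≤ p := by exact_mod_cast hpp.two_le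
      have hl : 0 ≤ Real.log p := Real.log_nonneg (by linarith)
      have hv : (n.factorial.factorization p : ℝ) ≤ n / ((p : ℝ) - 1) := by
        have h1 := Nat.factorization_factorial_le_div_pred hpp n
        have h2 : ((n / (p - 1) : ℕ) : ℝ) ≤ (n : ℝ) / ((p - 1 : ℕ) : ℝ) := Nat.cast_div_le
        rw [Nat.cast_pred hpp.pos] at h2
        exact le_trans (by exact_mod_cast h1) h2
      calc (n.factorial.factorization p : ℝ) * Real.log p
          ≤ n / ((p : ℝ) - 1) * Real.log p := by gcongr
        _ = n * (Real.log p / ((p : ℝ) - 1)) := by ring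
    have h5 : n * (Real.log n - 1) ≤ n * ∑ p ∈ primesLe y, Real.log p / ((p : ℝ) - 1) := by
      linarith
    exact le_of_mul_le_mul_left h5 hn0
  have := Real.log_two_gt_d9
  rcases le_or_gt 2 (Real.log n) with h | h <;> linarith

/-- A positive proportion of the weights `log p/(p-1)` sits on primes with `log p ≫ log y`. -/
theorem log_mul_sum_log_div_pred_le {y : ℝ} (hy : 2 ≤ y) :
    1 / 96 * Real.log y * ∑ p ∈ primesLe y, Real.log p / ((p : ℝ) - 1) ≤
      ∑ p ∈ primesLe y, Real.log p * (Real.log p / ((p : ℝ) - 1)) := by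
  have hy0 : 0 < y := by linarith
  have hLpos : 0 < Real.log y := Real.log_pos (by linarith)
  set z := y ^ (1 / 48 : ℝ) with hz
  have hz1 : 1 ≤ z := Real.one_le_rpow (by linarith) (by norm_num)
  have hzlog : Real.log z = 1 / 48 * Real.log y := Real.log_rpow hy0 _
  have hup := sum_log_div_pred_le hz1
  have hlow := le_sum_log_div_pred hy
  have hzy : z ≤ y := by
    conv_rhs => rw [← Real.rpow_one y]
    exact Real.rpow_le_rpow_of_exponent_le (by linarith) (by norm_num)
  have hnonneg : ∀ p ∈ primesLe y, 0 ≤ Real.log p / ((p : ℝ) - 1) := by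
    intro p hp
    have hp1 : (1 : ℝ) ≤ p := by exact_mod_cast (mem_filter.1 hp).2.one_le
    exact div_nonneg (Real.log_nonneg hp1) (by linarith)
  have hsub : primesLe z ⊆ primesLe y := by
    intro p hp
    rw [mem_primesLe (by linarith)] at hp ⊢
    exact ⟨hp.1, hp.2.trans hzy⟩
  have hsplit := Finset.sum_sdiff (f := fun p : ℕ => Real.log p / ((p : ℝ) - 1)) hsub
  have h1 : Real.log z * ∑ p ∈ primesLe y \ primesLe z, Real.log p / ((p : ℝ) - 1) ≤
      ∑ p ∈ primesLe y, Real.log p * (Real.log p / ((p : ℝ) - 1)) := by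
    rw [Finset.mul_sum]
    refine le_trans (Finset.sum_le_sum (g := fun p : ℕ => Real.log p * (Real.log p / ((p : ℝ) - 1)))
      fun p hp => ?_) (Finset.sum_le_sum_of_subset_of_nonneg Finset.sdiff_subset fun p hp _ => ?_)
    · rw [Finset.mem_sdiff] at hp
      refine mul_le_mul_of_nonneg_right ?_ (hnonneg p hp.1)
      have hpp := (mem_filter.1 hp.1).2
      have : z < p := by
        by_contra hcon
        exact hp.2 ((mem_primesLe (by linarith)).2 ⟨hpp, not_lt.1 hcon⟩)
      exact Real.log_le_log (by linarith) this.le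
    · have hp1 : (1 : ℝ) ≤ p := by exact_mod_cast (mem_filter.1 hp).2.one_le
      exact mul_nonneg (Real.log_nonneg hp1) (hnonneg p hp)
  refine le_trans ?_ h1
  have h2 : 1 / 2 * ∑ p ∈ primesLe y, Real.log p / ((p : ℝ) - 1) ≤
      ∑ p ∈ primesLe y \ primesLe z, Real.log p / ((p : ℝ) - 1) := by linarith
  rw [hzlog]
  nlinarith

/-- `(t-1)/(t^α-1)` is increasing in `t > 1` when `0 < α ≤ 1`. -/
theorem pred_div_rpow_pred_mono {α s t : ℝ} (hα : 0 < α) (hα1 : α ≤ 1) (hs : 1 < s) (hst : s ≤ t) :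
    (s - 1) / (s ^ α - 1) ≤ (t - 1) / (t ^ α - 1) := by
  rcases hst.eq_or_lt with rfl | hst
  · exact le_rfl
  have hsα : 1 < s ^ α := Real.one_lt_rpow hs hα
  have htα : 1 < t ^ α := Real.one_lt_rpow (by linarith) hα
  have h := (Real.concaveOn_rpow hα.le hα1).slope_anti_adjacent (x := 1) (y := s) (z := t)
    (by simp) (by simp; linarith) hs hst
  simp only [Real.one_rpow] at h
  rw [div_le_div_iff₀ (by linarith) (by linarith)] at h ⊢
  nlinarith

theorem log_mul_sum_log_div_rpow_pred_le {y α : ℝ} (hy : 2 ≤ y) (hα : 0 < α) (hα1 : α ≤ 1) :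
    1 / 96 * Real.log y * ∑ p ∈ primesLe y, Real.log p / ((p : ℝ) ^ α - 1) ≤
      ∑ p ∈ primesLe y, Real.log p * (Real.log p / ((p : ℝ) ^ α - 1)) := by
  set t := 1 / 96 * Real.log y with ht
  have hLpos : 0 < Real.log y := Real.log_pos (by linarith)
  have htpos : 0 < t := by positivity
  set m := (Real.exp t - 1) / ((Real.exp t) ^ α - 1) with hm
  have h1 : 1 < Real.exp t := Real.one_lt_exp_iff.2 htpos
  have h2 : 1 < (Real.exp t) ^ α := Real.one_lt_rpow h1 hα
  have hm0 : 0 ≤ m := div_nonneg (by linarith) (by linarith)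
  have hbase := log_mul_sum_log_div_pred_le hy
  rw [← ht] at hbase
  have key : m * ∑ p ∈ primesLe y, (Real.log p - t) * (Real.log p / ((p : ℝ) - 1)) ≤
      ∑ p ∈ primesLe y, (Real.log p - t) * (Real.log p / ((p : ℝ) ^ α - 1)) := by
    rw [Finset.mul_sum]
    refine Finset.sum_le_sum fun p hp => ?_
    have hpp := (mem_filter.1 hp).2
    have hp1 : (1 : ℝ) < p := by exact_mod_cast hpp.one_lt
    have hl : 0 < Real.log p := Real.log_pos hp1
    have hpα : 1 < (p : ℝ) ^ α := Real.one_lt_rpow hp1 hα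
    have hfac : Real.log p / ((p : ℝ) ^ α - 1) =
        ((p : ℝ) - 1) / ((p : ℝ) ^ α - 1) * (Real.log p / ((p : ℝ) - 1)) := by
      have : (p : ℝ) - 1 ≠ 0 := by linarith
      field_simp
    rw [hfac]
    have hq : 0 ≤ Real.log p / ((p : ℝ) - 1) := div_nonneg hl.le (by linarith)
    have hmono : m * (Real.log p - t) ≤ (p - 1) / ((p : ℝ) ^ α - 1) * (Real.log p - t) := by
      rcases le_total t (Real.log p) with h | h
      · refine mul_le_mul_of_nonneg_right ?_ (by linarith)
        exact pred_div_rpow_pred_mono hα hα1 h1 ((Real.le_log_iff_exp_le (by linarith)).1 h)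
      · refine mul_le_mul_of_nonpos_right ?_ (by linarith)
        exact pred_div_rpow_pred_mono hα hα1 hp1 ((Real.log_le_iff_le_exp (by linarith)).1 h)
    nlinarith
  have hpos : 0 ≤ ∑ p ∈ primesLe y, (Real.log p - t) * (Real.log p / ((p : ℝ) - 1)) := by
    simp only [sub_mul, Finset.sum_sub_distrib, ← Finset.mul_sum]
    linarith
  have := le_trans (mul_nonneg hm0 hpos) key
  simp only [sub_mul, Finset.sum_sub_distrib, ← Finset.mul_sum] at this
  linarith

/-- A family of functions that is uniformly bounded on `[-c, c]`. -/
def UnifBdd {ι : Type*} (c : ℝ) (φ : ι → ℝ → ℝ) : Prop :=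
  ∃ C : ℝ, ∀ i, ∀ w ∈ Set.Icc (-c) c, |φ i w| ≤ C

/-- A family of functions whose derivatives up to order `n` exist and are uniformly bounded
on `[-c, c]`. -/
def UnifSmooth {ι : Type*} (c : ℝ) : ℕ → (ι → ℝ → ℝ) → Prop
  | 0, φ => UnifBdd c φ
  | n + 1, φ => UnifBdd c φ ∧ ∃ ψ : ι → ℝ → ℝ,
      (∀ i, ∀ w ∈ Set.Icc (-c) c, HasDerivWithinAt (φ i) (ψ i w) (Set.Icc (-c) c) w) ∧
        UnifSmooth c n ψ

/-- Differentiation within `[-c, c]`. -/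
def derivIcc (c : ℝ) (f : ℝ → ℝ) : ℝ → ℝ := derivWithin f (Set.Icc (-c) c)

theorem UnifBdd.add {ι : Type*} {c : ℝ} {φ ψ : ι → ℝ → ℝ} (hφ : UnifBdd c φ) (hψ : UnifBdd c ψ) :
    UnifBdd c (fun i w => φ i w + ψ i w) := by
  obtain ⟨C, hC⟩ := hφ
  obtain ⟨D, hD⟩ := hψ
  exact ⟨C + D, fun i w hw => (abs_add_le _ _).trans (add_le_add (hC i w hw) (hD i w hw))⟩

theorem UnifBdd.mul {ι : Type*} {c : ℝ} {φ ψ : ι → ℝ → ℝ} (hφ : UnifBdd c φ) (hψ : UnifBdd c ψ) :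
    UnifBdd c (fun i w => φ i w * ψ i w) := by
  obtain ⟨C, hC⟩ := hφ
  obtain ⟨D, hD⟩ := hψ
  refine ⟨C * D, fun i w hw => ?_⟩
  rw [abs_mul]
  exact mul_le_mul (hC i w hw) (hD i w hw) (abs_nonneg _) ((abs_nonneg _).trans (hC i w hw))

namespace UnifSmooth

variable {ι : Type*} {c : ℝ} {φ ψ : ι → ℝ → ℝ} {n : ℕ}

theorem unifBdd (h : UnifSmooth c n φ) : UnifBdd c φ := by
  cases n with
  | zero => exact h
  | succ n => exact h.1

theorem of_succ (h : UnifSmooth c (n + 1) φ) : UnifSmooth c n φ := by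
  induction n generalizing φ with
  | zero => exact h.1
  | succ n ih =>
    obtain ⟨hb, φ', hd, h'⟩ := h
    exact ⟨hb, φ', hd, ih h'⟩

theorem congr (h : UnifSmooth c n φ) (heq : ∀ i, ∀ w ∈ Set.Icc (-c) c, ψ i w = φ i w) :
    UnifSmooth c n ψ := by
  have hb : UnifBdd c ψ := by
    obtain ⟨C, hC⟩ := h.unifBdd
    exact ⟨C, fun i w hw => by rw [heq i w hw]; exact hC i w hw⟩
  cases n with
  | zero => exact hb
  | succ n =>
    obtain ⟨-, φ', hd, h'⟩ := h
    exact ⟨hb, φ', fun i w hw => (hd i w hw).congr (heq i) (heq i w hw), h'⟩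

theorem reindex {κ : Type*} (h : UnifSmooth c n φ) (f : κ → ι) :
    UnifSmooth c n (fun k => φ (f k)) := by
  induction n generalizing φ with
  | zero =>
    obtain ⟨C, hC⟩ := h
    exact ⟨C, fun k => hC (f k)⟩
  | succ n ih =>
    obtain ⟨⟨C, hC⟩, φ', hd, h'⟩ := h
    exact ⟨⟨C, fun k => hC (f k)⟩, fun k => φ' (f k), fun k => hd (f k), ih h'⟩

theorem const {a : ι → ℝ} (C : ℝ) (ha : ∀ i, |a i| ≤ C) :
    UnifSmooth c n (fun i _ => a i) := by
  induction n generalizing a C with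
  | zero => exact ⟨C, fun i _ _ => ha i⟩
  | succ n ih =>
    exact ⟨⟨C, fun i _ _ => ha i⟩, fun _ _ => 0, fun i w _ => hasDerivWithinAt_const _ _ _,
      ih (a := fun _ => 0) 0 (by simp)⟩

theorem add (hφ : UnifSmooth c n φ) (hψ : UnifSmooth c n ψ) :
    UnifSmooth c n (fun i w => φ i w + ψ i w) := by
  induction n generalizing φ ψ with
  | zero => exact UnifBdd.add hφ hψ
  | succ n ih =>
    obtain ⟨hb, φ', hd, h'⟩ := hφ
    obtain ⟨kb, ψ', kd, k'⟩ := hψ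
    exact ⟨hb.add kb, fun i w => φ' i w + ψ' i w, fun i w hw => (hd i w hw).add (kd i w hw),
      ih h' k'⟩

theorem mul (hφ : UnifSmooth c n φ) (hψ : UnifSmooth c n ψ) :
    UnifSmooth c n (fun i w => φ i w * ψ i w) := by
  induction n generalizing φ ψ with
  | zero => exact UnifBdd.mul hφ hψ
  | succ n ih =>
    have hφ0 := hφ.of_succ
    have hψ0 := hψ.of_succ
    obtain ⟨hb, φ', hd, h'⟩ := hφ
    obtain ⟨kb, ψ', kd, k'⟩ := hψ
    exact ⟨hb.mul kb, fun i w => φ' i w * ψ i w + φ i w * ψ' i w,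
      fun i w hw => (hd i w hw).mul (kd i w hw), (ih h' hψ0).add (ih hφ0 k')⟩

theorem const_mul {a : ι → ℝ} (C : ℝ) (ha : ∀ i, |a i| ≤ C) (hφ : UnifSmooth c n φ) :
    UnifSmooth c n (fun i w => a i * φ i w) :=
  (UnifSmooth.const C ha).mul hφ

theorem neg (hφ : UnifSmooth c n φ) : UnifSmooth c n (fun i w => -φ i w) :=
  (hφ.const_mul (a := fun _ => -1) 1 (by simp)).congr (by simp)

theorem sub (hφ : UnifSmooth c n φ) (hψ : UnifSmooth c n ψ) :
    UnifSmooth c n (fun i w => φ i w - ψ i w) :=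
  (hφ.add hψ.neg).congr (fun _ _ _ => sub_eq_add_neg _ _)

theorem comp_neg (hφ : UnifSmooth c n φ) : UnifSmooth c n (fun i w => φ i (-w)) := by
  have hmem : ∀ w ∈ Set.Icc (-c) c, -w ∈ Set.Icc (-c) c := fun w hw =>
    ⟨by linarith [hw.2], by linarith [hw.1]⟩
  induction n generalizing φ with
  | zero =>
    obtain ⟨C, hC⟩ := hφ
    exact ⟨C, fun i w hw => hC i (-w) (hmem w hw)⟩
  | succ n ih =>
    obtain ⟨⟨C, hC⟩, φ', hd, h'⟩ := hφ
    refine ⟨⟨C, fun i w hw => hC i (-w) (hmem w hw)⟩, fun i w => -φ' i (-w), fun i w hw => ?_,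
      (ih h').neg⟩
    have := (hd i (-w) (hmem w hw)).scomp w (hasDerivWithinAt_neg w (Set.Icc (-c) c)) hmem
    simpa [Function.comp_def] using this

theorem comp {F : ℝ → ℝ} {K O : Set ℝ} (hK : IsCompact K) (hO : IsOpen O) (hKO : K ⊆ O)
    (hF : ContDiffOn ℝ (⊤ : ℕ∞) F O) (hφ : UnifSmooth c n φ)
    (hmem : ∀ i, ∀ w ∈ Set.Icc (-c) c, φ i w ∈ K) :
    UnifSmooth c n (fun i w => F (φ i w)) := by
  have hb : ∀ G : ℝ → ℝ, ContDiffOn ℝ (⊤ : ℕ∞) G O → UnifBdd c (fun i w => G (φ i w)) := by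
    intro G hG
    obtain ⟨C, hC⟩ := hK.exists_bound_of_continuousOn (hG.continuousOn.mono hKO)
    exact ⟨C, fun i w hw => hC _ (hmem i w hw)⟩
  induction n generalizing F with
  | zero => exact hb F hF
  | succ n ih =>
    have hφ0 := hφ.of_succ
    obtain ⟨-, φ', hd, h'⟩ := hφ
    have hF' : ContDiffOn ℝ (⊤ : ℕ∞) (deriv F) O := hF.deriv_of_isOpen hO (by simp)
    refine ⟨hb F hF, fun i w => deriv F (φ i w) * φ' i w, fun i w hw => ?_, (ih hF' hφ0).mul h'⟩
    have hdF : DifferentiableAt ℝ F (φ i w) :=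
      (hF.differentiableOn (by simp)).differentiableAt (hO.mem_nhds (hKO (hmem i w hw)))
    exact hdF.hasDerivAt.comp_hasDerivWithinAt w (hd i w hw)

theorem comp_contDiff {F : ℝ → ℝ} (hF : ContDiff ℝ (⊤ : ℕ∞) F) (hφ : UnifSmooth c n φ) :
    UnifSmooth c n (fun i w => F (φ i w)) := by
  obtain ⟨C, hC⟩ := hφ.unifBdd
  exact hφ.comp (K := Set.Icc (-C) C) isCompact_Icc isOpen_univ (Set.subset_univ _) hF.contDiffOn
    (fun i w hw => abs_le.1 (hC i w hw))

theorem inv {η : ℝ} (hη : 0 < η) (hφ : UnifSmooth c n φ)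
    (hlow : ∀ i, ∀ w ∈ Set.Icc (-c) c, η ≤ φ i w) :
    UnifSmooth c n (fun i w => (φ i w)⁻¹) := by
  obtain ⟨C, hC⟩ := hφ.unifBdd
  refine hφ.comp (K := Set.Icc η C) (O := Set.Ioi 0) (F := fun t => t⁻¹) isCompact_Icc isOpen_Ioi
    (fun t ht => hη.trans_le ht.1) ?_ (fun i w hw => ⟨hlow i w hw, (abs_le.1 (hC i w hw)).2⟩)
  exact contDiffOn_id.inv fun t ht => ne_of_gt ht

theorem log {η : ℝ} (hη : 0 < η) (hφ : UnifSmooth c n φ)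
    (hlow : ∀ i, ∀ w ∈ Set.Icc (-c) c, η ≤ φ i w) :
    UnifSmooth c n (fun i w => Real.log (φ i w)) := by
  obtain ⟨C, hC⟩ := hφ.unifBdd
  refine hφ.comp (K := Set.Icc η C) (O := Set.Ioi 0) (F := Real.log) isCompact_Icc isOpen_Ioi
    (fun t ht => hη.trans_le ht.1) ?_ (fun i w hw => ⟨hlow i w hw, (abs_le.1 (hC i w hw)).2⟩)
  exact contDiffOn_id.log fun t ht => ne_of_gt ht

theorem weighted_sum {κ : ι → Type*} [∀ i, Fintype (κ i)] {W : ∀ i, κ i → ℝ}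
    (hW : ∀ i p, 0 ≤ W i p) {D : ℝ} (hD : ∀ i, ∑ p, W i p ≤ D) {Φ : (Σ i, κ i) → ℝ → ℝ}
    (hΦ : UnifSmooth c n Φ) :
    UnifSmooth c n (fun i w => ∑ p, W i p * Φ ⟨i, p⟩ w) := by
  have hb : ∀ Ψ : (Σ i, κ i) → ℝ → ℝ, UnifBdd c Ψ →
      UnifBdd c (fun i w => ∑ p, W i p * Ψ ⟨i, p⟩ w) := by
    rintro Ψ ⟨C, hC⟩
    refine ⟨D * |C|, fun i w hw => ?_⟩
    calc |∑ p, W i p * Ψ ⟨i, p⟩ w| ≤ ∑ p, |W i p * Ψ ⟨i, p⟩ w| := Finset.abs_sum_le_sum_abs _ _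
      _ ≤ ∑ p, W i p * |C| := by
          refine Finset.sum_le_sum fun p _ => ?_
          rw [abs_mul, abs_of_nonneg (hW i p)]
          exact mul_le_mul_of_nonneg_left ((hC ⟨i, p⟩ w hw).trans (le_abs_self C)) (hW i p)
      _ = (∑ p, W i p) * |C| := by rw [Finset.sum_mul]
      _ ≤ D * |C| := mul_le_mul_of_nonneg_right (hD i) (abs_nonneg _)
  induction n generalizing Φ with
  | zero => exact hb Φ hΦ
  | succ n ih =>
    obtain ⟨h0, Φ', hd, h'⟩ := hΦ
    refine ⟨hb Φ h0, fun i w => ∑ p, W i p * Φ' ⟨i, p⟩ w, fun i w hw => ?_, ih h'⟩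
    exact HasDerivWithinAt.fun_sum fun p _ => (hd ⟨i, p⟩ w hw).const_mul _

theorem derivIcc (hc : 0 < c) (h : UnifSmooth c (n + 1) φ) :
    (∀ i, ∀ w ∈ Set.Icc (-c) c,
      HasDerivWithinAt (φ i) (derivIcc c (φ i) w) (Set.Icc (-c) c) w) ∧
      UnifSmooth c n (fun i => derivIcc c (φ i)) := by
  obtain ⟨-, φ', hd, h'⟩ := h
  have heq : ∀ i, ∀ w ∈ Set.Icc (-c) c, _root_.derivIcc c (φ i) w = φ' i w := fun i w hw =>
    (hd i w hw).derivWithin (uniqueDiffOn_Icc (by linarith) w hw)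
  exact ⟨fun i w hw => by rw [heq i w hw]; exact hd i w hw, h'.congr heq⟩

theorem exists_abs_iterate_derivIcc_le (hc : 0 < c) (h : UnifSmooth c n φ) :
    ∃ C, ∀ i, |((_root_.derivIcc c)^[n] (φ i)) 0| ≤ C := by
  induction n generalizing φ with
  | zero =>
    obtain ⟨C, hC⟩ := h
    exact ⟨C, fun i => hC i 0 ⟨by linarith, hc.le⟩⟩
  | succ n ih => exact ih (h.derivIcc hc).2

/-- Taylor's formula at `0`, uniformly in the family. -/
theorem exists_taylor (hc : 0 < c) (h : UnifSmooth c n φ) :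
    ∃ C, ∀ i, ∀ w ∈ Set.Icc (-c) c,
      |φ i w - ∑ j ∈ Finset.range n,
        ((_root_.derivIcc c)^[j] (φ i)) 0 / j.factorial * w ^ j| ≤ C * |w| ^ n := by
  induction n generalizing φ with
  | zero =>
    obtain ⟨C, hC⟩ := h
    exact ⟨C, fun i w hw => by simpa using hC i w hw⟩
  | succ n ih =>
    obtain ⟨hd, h'⟩ := h.derivIcc hc
    obtain ⟨C, hC⟩ := ih h'
    refine ⟨|C|, fun i w hw => ?_⟩
    set a : ℕ → ℝ := fun j => ((_root_.derivIcc c)^[j] (φ i)) 0 with ha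
    have h0 : (0 : ℝ) ∈ Set.Icc (-c) c := ⟨by linarith, hc.le⟩
    have hsub : Set.uIcc 0 w ⊆ Set.Icc (-c) c := Set.ordConnected_Icc.uIcc_subset h0 hw
    have hR : ∀ t ∈ Set.uIcc 0 w, HasDerivWithinAt
        (fun t => φ i t - ∑ j ∈ Finset.range (n + 1), a j / j.factorial * t ^ j)
        (_root_.derivIcc c (φ i) t - ∑ j ∈ Finset.range n, a (j + 1) / j.factorial * t ^ j)
        (Set.uIcc 0 w) t := by
      intro t ht
      refine ((hd i t (hsub ht)).mono hsub).sub ?_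
      have h1 : HasDerivWithinAt
          (fun t : ℝ => ∑ j ∈ Finset.range n, a (j + 1) / (j + 1).factorial * t ^ (j + 1))
          (∑ j ∈ Finset.range n, a (j + 1) / j.factorial * t ^ j) (Set.uIcc 0 w) t := by
        refine HasDerivWithinAt.fun_sum fun j _ => ?_
        convert ((hasDerivAt_pow (j + 1) t).const_mul
          (a (j + 1) / (j + 1).factorial)).hasDerivWithinAt using 1
        rw [Nat.factorial_succ]
        push_cast
        have : (j.factorial : ℝ) ≠ 0 := by positivity
        field_simp
      simp only [Finset.sum_range_succ']
      simpa using h1.add_const (a 0 / (Nat.factorial 0) * t ^ 0)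
    have hbound : ∀ t ∈ Set.uIcc 0 w,
        ‖_root_.derivIcc c (φ i) t - ∑ j ∈ Finset.range n, a (j + 1) / j.factorial * t ^ j‖ ≤
          |C| * |w| ^ n := by
      intro t ht
      have habs : |t| ≤ |w| := by
        have := Set.abs_sub_left_of_mem_uIcc ht
        simpa using this
      refine (hC i t (hsub ht)).trans ?_
      refine mul_le_mul (le_abs_self C) ?_ (by positivity) (abs_nonneg C)
      gcongr
    have := (convex_uIcc 0 w).norm_image_sub_le_of_norm_hasDerivWithin_le hR hbound
      Set.left_mem_uIcc Set.right_mem_uIcc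
    have hz : φ i 0 - ∑ j ∈ Finset.range (n + 1), a j / j.factorial * (0 : ℝ) ^ j = 0 := by
      simp [Finset.sum_range_succ', ha]
    rw [hz, sub_zero, sub_zero, Real.norm_eq_abs, Real.norm_eq_abs, mul_assoc, ← pow_succ] at this
    exact this

/-- Taylor's formula at `0` for an even family. -/
theorem exists_taylor_even (hc : 0 < c) (k : ℕ) (h : UnifSmooth c (2 * k) φ)
    (heven : ∀ i, ∀ w ∈ Set.Icc (-c) c, φ i (-w) = φ i w) :
    ∃ C, ∀ i, ∀ w ∈ Set.Icc (-c) c,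
      |φ i w - ∑ j ∈ Finset.range k,
        ((_root_.derivIcc c)^[2 * j] (φ i)) 0 / (2 * j).factorial * w ^ (2 * j)| ≤
          C * w ^ (2 * k) := by
  obtain ⟨C, hC⟩ := h.exists_taylor hc
  refine ⟨C, fun i w hw => ?_⟩
  have hw' : -w ∈ Set.Icc (-c) c := ⟨by linarith [hw.2], by linarith [hw.1]⟩
  have h1 := hC i w hw
  have h2 := hC i (-w) hw'
  rw [heven i w hw, abs_neg] at h2
  have hpow : |w| ^ (2 * k) = w ^ (2 * k) := (even_two_mul k).pow_abs w
  rw [hpow] at h1 h2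
  set a : ℕ → ℝ := fun j => ((_root_.derivIcc c)^[j] (φ i)) 0 / j.factorial with ha
  have hsum : ∀ m : ℕ, ∑ j ∈ Finset.range (2 * m), a j * w ^ j +
      ∑ j ∈ Finset.range (2 * m), a j * (-w) ^ j =
        2 * ∑ j ∈ Finset.range m, a (2 * j) * w ^ (2 * j) := by
    intro m
    induction m with
    | zero => simp
    | succ m ih =>
      rw [show 2 * (m + 1) = 2 * m + 1 + 1 by ring, Finset.sum_range_succ, Finset.sum_range_succ,
        Finset.sum_range_succ _ (2 * m + 1), Finset.sum_range_succ _ (2 * m),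
        Finset.sum_range_succ _ m, (even_two_mul m).neg_pow, Odd.neg_pow ⟨m, rfl⟩]
      linarith
  have hk := hsum k
  rw [abs_le] at h1 h2 ⊢
  constructor <;> linarith [h1.1, h1.2, h2.1, h2.2]

end UnifSmooth

/-- The entire function `2 sinh(z/2)/z`. -/
def sinhRatioC (z : ℂ) : ℂ := dslope (fun z : ℂ => 2 * Complex.sinh (z / 2)) 0 z

/-- The restriction of `2 sinh(z/2)/z` to the real line. -/
def sinhRatio (x : ℝ) : ℝ := (sinhRatioC x).re

theorem mul_sinhRatioC (z : ℂ) : z * sinhRatioC z = 2 * Complex.sinh (z / 2) := by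
  have := sub_smul_dslope (fun z : ℂ => 2 * Complex.sinh (z / 2)) 0 z
  simpa [sinhRatioC] using this

theorem differentiable_sinhRatioC : Differentiable ℂ sinhRatioC := by
  have h : DifferentiableOn ℂ (dslope (fun z : ℂ => 2 * Complex.sinh (z / 2)) 0) Set.univ := by
    rw [Complex.differentiableOn_dslope Filter.univ_mem]
    fun_prop
  exact differentiableOn_univ.1 h

theorem sinhRatioC_zero : sinhRatioC 0 = 1 := by
  have h : HasDerivAt (fun z : ℂ => 2 * Complex.sinh (z / 2)) 1 0 := by
    have := (((hasDerivAt_id (0 : ℂ)).div_const 2).csinh).const_mul 2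
    simpa using this
  rw [sinhRatioC, dslope_same, h.deriv]

theorem sinhRatioC_neg (z : ℂ) : sinhRatioC (-z) = sinhRatioC z := by
  rcases eq_or_ne z 0 with rfl | hz
  · simp
  · have h1 := mul_sinhRatioC z
    have h2 := mul_sinhRatioC (-z)
    rw [neg_div, Complex.sinh_neg] at h2
    refine mul_left_cancel₀ hz ?_
    linear_combination -h2 - h1

theorem ofReal_sinhRatio (x : ℝ) : ((sinhRatio x : ℝ) : ℂ) = sinhRatioC x := by
  rcases eq_or_ne x 0 with rfl | hx
  · simp [sinhRatio, sinhRatioC_zero]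
  · have hx' : (x : ℂ) ≠ 0 := by exact_mod_cast hx
    have h : sinhRatioC x = ((2 * Real.sinh (x / 2) / x : ℝ) : ℂ) := by
      refine mul_left_cancel₀ hx' ?_
      rw [mul_sinhRatioC]
      push_cast
      field_simp
    rw [sinhRatio, h, Complex.ofReal_re]

/-- If an entire function is real on the real line then so is its derivative. -/
theorem hasDerivAt_of_ofReal_eq {F : ℂ → ℂ} {f : ℝ → ℝ} (hF : Differentiable ℂ F)
    (hf : ∀ x : ℝ, ((f x : ℝ) : ℂ) = F x) (x : ℝ) :
    HasDerivAt f (deriv F x).re x ∧ ((deriv f x : ℝ) : ℂ) = deriv F x := by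
  have h1 : HasDerivAt f (deriv F x).re x := by
    have := (hF x).hasDerivAt.real_of_complex
    refine this.congr_of_eventuallyEq (Filter.Eventually.of_forall fun t => ?_)
    change f t = (F t).re
    rw [← hf, Complex.ofReal_re]
  refine ⟨h1, ?_⟩
  have h2 : HasDerivAt (fun t : ℝ => F t) (deriv F x) x := (hF x).hasDerivAt.comp_ofReal
  have h3 : HasDerivAt (fun t : ℝ => F t) (((deriv F x).re : ℝ) : ℂ) x := by
    have := h1.ofReal_comp
    simpa only [hf] using this
  rw [h1.deriv]
  exact h3.unique h2

theorem contDiff_sinhRatio : ContDiff ℝ (⊤ : ℕ∞) sinhRatio :=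
  (differentiable_sinhRatioC.contDiff (n := (⊤ : ℕ∞))).real_of_complex

theorem ofReal_deriv_sinhRatio (x : ℝ) :
    ((deriv sinhRatio x : ℝ) : ℂ) = deriv sinhRatioC x :=
  (hasDerivAt_of_ofReal_eq differentiable_sinhRatioC ofReal_sinhRatio x).2

theorem differentiable_deriv_sinhRatioC : Differentiable ℂ (deriv sinhRatioC) := fun z =>
  ((differentiable_sinhRatioC.contDiff (n := 2)).differentiable_deriv_two) z

theorem ofReal_deriv_deriv_sinhRatio (x : ℝ) :
    ((deriv (deriv sinhRatio) x : ℝ) : ℂ) = deriv (deriv sinhRatioC) x :=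
  (hasDerivAt_of_ofReal_eq differentiable_deriv_sinhRatioC ofReal_deriv_sinhRatio x).2

theorem contDiff_deriv_sinhRatio : ContDiff ℝ (⊤ : ℕ∞) (deriv sinhRatio) :=
  (contDiff_infty_iff_deriv.1 contDiff_sinhRatio).2

theorem contDiff_deriv_deriv_sinhRatio : ContDiff ℝ (⊤ : ℕ∞) (deriv (deriv sinhRatio)) :=
  (contDiff_infty_iff_deriv.1 contDiff_deriv_sinhRatio).2

theorem hasDerivAt_sinhRatio (x : ℝ) : HasDerivAt sinhRatio (deriv sinhRatio x) x :=
  (contDiff_sinhRatio.differentiable (by simp) x).hasDerivAt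

theorem hasDerivAt_deriv_sinhRatio (x : ℝ) :
    HasDerivAt (deriv sinhRatio) (deriv (deriv sinhRatio) x) x :=
  (contDiff_deriv_sinhRatio.differentiable (by simp) x).hasDerivAt

theorem sinhRatio_neg (x : ℝ) : sinhRatio (-x) = sinhRatio x := by
  simp [sinhRatio, sinhRatioC_neg]

theorem deriv_sinhRatio_neg (x : ℝ) : deriv sinhRatio (-x) = -deriv sinhRatio x := by
  have h := deriv_comp_neg sinhRatio x
  rw [show (fun x => sinhRatio (-x)) = sinhRatio from funext sinhRatio_neg] at h
  linarith

theorem deriv_deriv_sinhRatio_neg (x : ℝ) :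
    deriv (deriv sinhRatio) (-x) = deriv (deriv sinhRatio) x := by
  have h := deriv_comp_neg (deriv sinhRatio) x
  rw [show (fun x => deriv sinhRatio (-x)) = fun x => -deriv sinhRatio x from
    funext deriv_sinhRatio_neg, deriv.fun_neg] at h
  linarith

theorem mul_sinhRatio (x : ℝ) : x * sinhRatio x = 2 * Real.sinh (x / 2) := by
  have := mul_sinhRatioC x
  rw [← ofReal_sinhRatio] at this
  exact_mod_cast this

theorem sinhRatio_add_mul_deriv (x : ℝ) :
    sinhRatio x + x * deriv sinhRatio x = Real.cosh (x / 2) := by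
  have h1 := (hasDerivAt_id x).mul (hasDerivAt_sinhRatio x)
  have h2 : HasDerivAt (fun x : ℝ => 2 * Real.sinh (x / 2)) (Real.cosh (x / 2)) x := by
    refine ((((hasDerivAt_id x).div_const 2).sinh).const_mul 2).congr_deriv ?_
    simp only [id]
    ring
  have h3 : (id * sinhRatio : ℝ → ℝ) = fun x : ℝ => 2 * Real.sinh (x / 2) :=
    funext mul_sinhRatio
  rw [h3] at h1
  simpa using h1.unique h2

theorem two_mul_deriv_sinhRatio_add (x : ℝ) :
    2 * deriv sinhRatio x + x * deriv (deriv sinhRatio) x = x * sinhRatio x / 4 := by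
  have h1 := (hasDerivAt_sinhRatio x).add
    ((hasDerivAt_id x).mul (hasDerivAt_deriv_sinhRatio x))
  have h2 : HasDerivAt (fun x : ℝ => Real.cosh (x / 2)) (Real.sinh (x / 2) * (1 / 2)) x :=
    ((hasDerivAt_id x).div_const 2).cosh
  have h3 : (sinhRatio + id * deriv sinhRatio : ℝ → ℝ) = fun x : ℝ => Real.cosh (x / 2) :=
    funext sinhRatio_add_mul_deriv
  rw [h3] at h1
  have := h1.unique h2
  have := mul_sinhRatio x
  simp only [id] at *
  linarith

theorem sinhRatio_zero : sinhRatio 0 = 1 := by simpa using sinhRatio_add_mul_deriv 0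

theorem deriv_sinhRatio_zero : deriv sinhRatio 0 = 0 := by
  simpa using two_mul_deriv_sinhRatio_add 0

theorem deriv_deriv_sinhRatio_zero : deriv (deriv sinhRatio) 0 = 1 / 12 := by
  have hd3 : HasDerivAt (deriv (deriv sinhRatio)) (deriv (deriv (deriv sinhRatio)) 0) 0 :=
    (contDiff_deriv_deriv_sinhRatio.differentiable (by simp) 0).hasDerivAt
  have h1 := ((hasDerivAt_deriv_sinhRatio 0).const_mul 2).add
    ((hasDerivAt_id (0 : ℝ)).mul hd3)
  have h2 := ((hasDerivAt_id (0 : ℝ)).mul (hasDerivAt_sinhRatio 0)).div_const 4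
  have h3 : ((fun x => 2 * deriv sinhRatio x) + id * deriv (deriv sinhRatio) : ℝ → ℝ) =
      fun x : ℝ => (id * sinhRatio : ℝ → ℝ) x / 4 := funext two_mul_deriv_sinhRatio_add
  rw [h3] at h1
  have := h1.unique h2
  simp only [id, sinhRatio_zero] at this
  linarith

theorem one_lt_sinhRatio {x : ℝ} (hx : 0 < x) : 1 < sinhRatio x := by
  have h := Real.self_lt_sinh_iff.2 (half_pos hx)
  have := mul_sinhRatio x
  nlinarith

theorem sinhRatio_pos (x : ℝ) : 0 < sinhRatio x := by
  rcases lt_trichotomy x 0 with h | rfl | h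
  · rw [← sinhRatio_neg]; linarith [one_lt_sinhRatio (neg_pos.2 h)]
  · simp [sinhRatio_zero]
  · linarith [one_lt_sinhRatio h]

theorem deriv_sinhRatio_pos {x : ℝ} (hx : 0 < x) : 0 < deriv sinhRatio x := by
  have hx2 : (0 : ℝ) < x / 2 := half_pos hx
  obtain ⟨t, ht, hslope⟩ := exists_deriv_eq_slope Real.sinh hx2 Real.continuous_sinh.continuousOn
    Real.differentiable_sinh.differentiableOn
  rw [Real.deriv_sinh, Real.sinh_zero, sub_zero, sub_zero] at hslope
  have hcosh : Real.cosh t < Real.cosh (x / 2) := by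
    rw [Real.cosh_lt_cosh, abs_of_pos ht.1, abs_of_pos hx2]
    exact ht.2
  rw [hslope, div_lt_iff₀ hx2] at hcosh
  have h1 := sinhRatio_add_mul_deriv x
  have h2 := mul_sinhRatio x
  have h3 : 0 < x * (x * deriv sinhRatio x) := by nlinarith
  exact pos_of_mul_pos_right (pos_of_mul_pos_right h3 hx.le) hx.le

theorem abs_deriv_sinhRatio_lt (x : ℝ) : |deriv sinhRatio x| < sinhRatio x / 2 := by
  have hpos : ∀ x : ℝ, 0 < x → |deriv sinhRatio x| < sinhRatio x / 2 := by
    intro x hx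
    rw [abs_of_pos (deriv_sinhRatio_pos hx)]
    have h1 := sinhRatio_add_mul_deriv x
    have h2 := mul_sinhRatio x
    have h3 := one_lt_sinhRatio hx
    have h4 : Real.cosh (x / 2) - Real.sinh (x / 2) < 1 := by
      rw [Real.cosh_sub_sinh]
      exact Real.exp_lt_one_iff.2 (by linarith)
    have h5 : x * deriv sinhRatio x < x * (sinhRatio x / 2) := by linarith
    exact lt_of_mul_lt_mul_left h5 hx.le
  rcases lt_trichotomy x 0 with h | rfl | h
  · have := hpos (-x) (neg_pos.2 h)
    rwa [sinhRatio_neg, deriv_sinhRatio_neg, abs_neg] at this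
  · simp [deriv_sinhRatio_zero, sinhRatio_zero]
  · exact hpos x h

theorem deriv_deriv_sinhRatio_lt (x : ℝ) : deriv (deriv sinhRatio) x < sinhRatio x / 4 := by
  have hpos : ∀ x : ℝ, 0 < x → deriv (deriv sinhRatio) x < sinhRatio x / 4 := by
    intro x hx
    have h1 := two_mul_deriv_sinhRatio_add x
    have h2 := deriv_sinhRatio_pos hx
    have h5 : x * deriv (deriv sinhRatio) x < x * (sinhRatio x / 4) := by linarith
    exact lt_of_mul_lt_mul_left h5 hx.le
  rcases lt_trichotomy x 0 with h | rfl | h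
  · have := hpos (-x) (neg_pos.2 h)
    rwa [sinhRatio_neg, deriv_deriv_sinhRatio_neg] at this
  · rw [deriv_deriv_sinhRatio_zero, sinhRatio_zero]; norm_num
  · exact hpos x h

/-- The first derivative of `log (2 sinh(x/2)/x)`. -/
def hOne (x : ℝ) : ℝ := deriv sinhRatio x / sinhRatio x

/-- The second derivative of `log (2 sinh(x/2)/x)`. -/
def hTwo (x : ℝ) : ℝ := deriv (deriv sinhRatio) x / sinhRatio x - hOne x ^ 2

theorem contDiff_hOne : ContDiff ℝ (⊤ : ℕ∞) hOne :=
  contDiff_deriv_sinhRatio.div contDiff_sinhRatio fun x => (sinhRatio_pos x).ne'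

theorem contDiff_hTwo : ContDiff ℝ (⊤ : ℕ∞) hTwo :=
  (contDiff_deriv_deriv_sinhRatio.div contDiff_sinhRatio fun x => (sinhRatio_pos x).ne').sub
    (contDiff_hOne.pow 2)

theorem hasDerivAt_log_sinhRatio (x : ℝ) :
    HasDerivAt (fun x => Real.log (sinhRatio x)) (hOne x) x :=
  (hasDerivAt_sinhRatio x).log (sinhRatio_pos x).ne'

theorem hasDerivAt_hOne (x : ℝ) : HasDerivAt hOne (hTwo x) x := by
  have h := (hasDerivAt_deriv_sinhRatio x).div (hasDerivAt_sinhRatio x) (sinhRatio_pos x).ne'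
  refine h.congr_deriv ?_
  have := (sinhRatio_pos x).ne'
  unfold hTwo hOne
  field_simp

theorem hOne_neg (x : ℝ) : hOne (-x) = -hOne x := by
  simp [hOne, deriv_sinhRatio_neg, sinhRatio_neg, neg_div]

theorem hTwo_neg (x : ℝ) : hTwo (-x) = hTwo x := by
  simp [hTwo, hOne_neg, deriv_deriv_sinhRatio_neg, sinhRatio_neg]

theorem hOne_zero : hOne 0 = 0 := by simp [hOne, deriv_sinhRatio_zero]

theorem hTwo_zero : hTwo 0 = 1 / 12 := by
  simp [hTwo, hOne_zero, deriv_deriv_sinhRatio_zero, sinhRatio_zero]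

theorem abs_hOne_lt (x : ℝ) : |hOne x| < 1 / 2 := by
  have h := sinhRatio_pos x
  rw [hOne, abs_div, abs_of_pos h, div_lt_iff₀ h]
  linarith [abs_deriv_sinhRatio_lt x]

theorem hTwo_lt (x : ℝ) : hTwo x < 1 / 4 - hOne x ^ 2 := by
  have h := sinhRatio_pos x
  have : deriv (deriv sinhRatio) x / sinhRatio x < 1 / 4 := by
    rw [div_lt_iff₀ h]
    linarith [deriv_deriv_sinhRatio_lt x]
  rw [hTwo]
  linarith

theorem binaryForm_nonneg {A B q : ℝ} (hdet : 0 ≤ A * B - q ^ 2) (htr : 0 < A + B) (s t : ℝ) :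
    0 ≤ A * s ^ 2 + 2 * q * s * t + B * t ^ 2 := by
  have h3 : (A + B) * (A * s ^ 2 + 2 * q * s * t + B * t ^ 2) =
      (A * s + q * t) ^ 2 + (B * t + q * s) ^ 2 + (A * B - q ^ 2) * (s ^ 2 + t ^ 2) := by ring
  have h4 : 0 ≤ (A + B) * (A * s ^ 2 + 2 * q * s * t + B * t ^ 2) := by rw [h3]; positivity
  exact nonneg_of_mul_nonneg_right h4 htr

/-- Uniform positivity, for `|x| ≤ M`, of the quadratic form
`(1/2 - h'(x)) s² + (1/2 + h'(x)) t² - h''(x) (s - t)²`. -/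
theorem exists_quadraticForm_ge (M : ℝ) : ∃ θ : ℝ, 0 < θ ∧ ∀ x : ℝ, |x| ≤ M →
    θ ≤ 1 / 2 - hOne x ∧ θ ≤ 1 / 2 + hOne x ∧ ∀ s t : ℝ, θ * (s ^ 2 + t ^ 2) ≤
      (1 / 2 - hOne x) * s ^ 2 + (1 / 2 + hOne x) * t ^ 2 - hTwo x * (s - t) ^ 2 := by
  rcases lt_or_ge M 0 with hM | hM
  · exact ⟨1, one_pos, fun x hx => absurd ((abs_nonneg x).trans hx) (not_le.2 hM)⟩
  have hne : (Set.Icc (-M) M).Nonempty := ⟨0, by constructor <;> linarith⟩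
  have h1 := contDiff_hOne.continuous
  have h2 := contDiff_hTwo.continuous
  obtain ⟨x1, -, m1⟩ := (isCompact_Icc (a := -M) (b := M)).exists_isMinOn hne
    (f := fun x => 1 / 4 - hOne x ^ 2 - hTwo x) (by fun_prop)
  obtain ⟨x2, -, m2⟩ := (isCompact_Icc (a := -M) (b := M)).exists_isMinOn hne
    (f := fun x => 1 / 2 - |hOne x|) (by fun_prop)
  obtain ⟨D, hD⟩ := (isCompact_Icc (a := -M) (b := M)).exists_bound_of_continuousOn
    h2.continuousOn
  set d := 1 / 4 - hOne x1 ^ 2 - hTwo x1 with hd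
  set e := 1 / 2 - |hOne x2| with he
  have hdpos : 0 < d := by have := hTwo_lt x1; rw [hd]; linarith
  have hepos : 0 < e := by have := abs_hOne_lt x2; rw [he]; linarith
  have hD0 : 0 ≤ D := (norm_nonneg _).trans (hD 0 (by constructor <;> linarith))
  refine ⟨min e (d / (1 + 2 * D)), lt_min hepos (by positivity), fun x hx => ?_⟩
  have hxm : x ∈ Set.Icc (-M) M := abs_le.1 hx
  have k1 : d ≤ 1 / 4 - hOne x ^ 2 - hTwo x := m1 hxm
  have k2 : e ≤ 1 / 2 - |hOne x| := m2 hxm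
  have k3 := abs_le.1 (hD x hxm)
  have hle := le_abs_self (hOne x)
  have hge := neg_abs_le (hOne x)
  refine ⟨(min_le_left _ _).trans (by linarith), (min_le_left _ _).trans (by linarith),
    fun s t => ?_⟩
  set θ := min e (d / (1 + 2 * D)) with hθ
  have hθpos : 0 < θ := lt_min hepos (by positivity)
  have hθd : θ * (1 + 2 * D) ≤ d := by
    rw [← le_div_iff₀ (by positivity)]; exact min_le_right _ _
  set P := 1 / 2 - hOne x with hP
  set q := hTwo x with hq
  have hQ : 1 / 2 + hOne x = 1 - P := by rw [hP]; ring
  rw [hQ]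
  have hdet : d ≤ P * (1 - P) - q := by rw [hP]; nlinarith
  have hP0 : 0 < P := by linarith
  have hP1 : 0 < 1 - P := by linarith
  -- the matrix `[[P - q - θ, q], [q, 1 - P - q - θ]]` is positive semidefinite
  have hdet' : 0 ≤ (P - q - θ) * (1 - P - q - θ) - q ^ 2 := by nlinarith
  have htr : 0 < (P - q - θ) + (1 - P - q - θ) := by
    have : P * (1 - P) ≤ 1 / 4 := by nlinarith [sq_nonneg (P - 1 / 2)]
    have : θ ≤ d := by nlinarith
    nlinarith
  have hfin := binaryForm_nonneg hdet' htr s t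
  nlinarith

theorem HasDerivWithinAt.comp_neg_Icc {f : ℝ → ℝ} {f' c w : ℝ}
    (h : HasDerivWithinAt f f' (Set.Icc (-c) c) (-w)) :
    HasDerivWithinAt (fun t => f (-t)) (-f') (Set.Icc (-c) c) w := by
  have := h.scomp w (hasDerivWithinAt_neg w (Set.Icc (-c) c))
    (fun t ht => ⟨by linarith [ht.2], by linarith [ht.1]⟩)
  simpa [Function.comp_def] using this

theorem abs_exp_sub_one_le_mul_exp (x : ℝ) : |Real.exp x - 1| ≤ |x| * Real.exp |x| := by
  have h1 := Real.add_one_le_exp x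
  have h2 := Real.add_one_le_exp (-x)
  have h3 : Real.exp x * Real.exp (-x) = 1 := by rw [← Real.exp_add]; simp
  have h4 := Real.exp_pos x
  have h5 : Real.exp x ≤ Real.exp |x| := Real.exp_le_exp.2 (le_abs_self x)
  have h6 : 1 ≤ Real.exp |x| := Real.one_le_exp (abs_nonneg x)
  have h7 := neg_abs_le x
  have h8 := le_abs_self x
  have h9 := abs_nonneg x
  rw [abs_le]
  constructor
  · nlinarith
  · have : Real.exp x - 1 ≤ x * Real.exp x := by nlinarith
    nlinarith

/-- The rescaled saddle-point problem: for each `p`, the function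
`t ↦ -log(1 - p^{-α-t/T})` is, up to an additive constant, `t ↦ λ t - log(1 + γ (e^{λt} - 1)/λ)`
with `λ = (log p)/T` and `γ = λ/(1-p^{-α})`, and `B` is the rescaled saddle-point curve. -/
structure SaddleCurve (c M η c₀ : ℝ) where
  K : Type
  [fintypeK : Fintype K]
  lam : K → ℝ
  gam : K → ℝ
  kap : ℝ
  rho : ℝ
  B : ℝ → ℝ
  lam_pos : ∀ p, 0 < lam p
  lam_le_gam : ∀ p, lam p ≤ gam p
  gam_le_one : ∀ p, gam p ≤ 1
  kap_nonneg : 0 ≤ kap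
  sum_le_one : ∑ p, kap * (gam p - lam p) ≤ 1
  le_sum : c₀ ≤ ∑ p, kap * (gam p - lam p) * gam p
  differentiableOn_B : DifferentiableOn ℝ B (Set.Icc (-c) c)
  B_zero : B 0 = 0
  abs_B_le : ∀ w ∈ Set.Icc (-c) c, |B w| ≤ M
  le_r : ∀ p, ∀ w ∈ Set.Icc (-c) c, η ≤ 1 + gam p * ((Real.exp (lam p * B w) - 1) / lam p)
  rho_nonneg : 0 ≤ rho
  two_mul_rho_sq : 2 * rho ^ 2 =
    ∑ p, kap * (gam p - lam p) * (gam p / 2 - (gam p - lam p) / 6)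
  saddle : ∀ w ∈ Set.Icc (-c) c,
    ∑ p, kap * (gam p - lam p) *
      (-(1 + gam p * ((Real.exp (lam p * B w) - 1) / lam p))⁻¹ * (1 / 2 - hOne
        ((lam p * B w - Real.log (1 + gam p * ((Real.exp (lam p * B w) - 1) / lam p))) -
        (lam p * B (-w) - Real.log (1 + gam p * ((Real.exp (lam p * B (-w)) - 1) / lam p)))))) =
      rho * w - (∑ p, kap * (gam p - lam p)) / 2

attribute [instance] SaddleCurve.fintypeK

namespace SaddleCurve

variable {c M η c₀ : ℝ}

/-- The weight of the index `p`. -/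
def W (D : SaddleCurve c M η c₀) (p : D.K) : ℝ := D.kap * (D.gam p - D.lam p)

/-- The rescaled value of `p^β - 1`. -/
def r (D : SaddleCurve c M η c₀) (p : D.K) (w : ℝ) : ℝ :=
  1 + D.gam p * ((Real.exp (D.lam p * D.B w) - 1) / D.lam p)

/-- The increment of `-log(1-p^{-β})` along the curve. -/
def a (D : SaddleCurve c M η c₀) (p : D.K) (w : ℝ) : ℝ :=
  D.lam p * D.B w - Real.log (D.r p w)

/-- The difference of the values of `-log(1-p^{-s})` at the two components of the curve. -/
def gap (D : SaddleCurve c M η c₀) (p : D.K) (w : ℝ) : ℝ := D.a p w - D.a p (-w)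

/-- The rescaled second derivative in the first variable along the curve. -/
def F20 (D : SaddleCurve c M η c₀) (w : ℝ) : ℝ :=
  ∑ p, D.W p * ((D.r p w)⁻¹ * (D.r p w)⁻¹ *
    (D.gam p * Real.exp (D.lam p * D.B w) * (1 / 2 - hOne (D.gap p w)) -
      (D.gam p - D.lam p) * hTwo (D.gap p w)))

/-- The rescaled mixed second derivative along the curve. -/
def F11 (D : SaddleCurve c M η c₀) (w : ℝ) : ℝ :=
  ∑ p, D.W p * ((D.r p w)⁻¹ * (D.r p (-w))⁻¹ * ((D.gam p - D.lam p) * hTwo (D.gap p w)))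

/-- The rescaled Hessian along the curve. -/
def hess (D : SaddleCurve c M η c₀) (w : ℝ) : ℝ := D.F20 w * D.F20 (-w) - D.F11 w ^ 2

/-- The rescaled energy along the curve. -/
def energy (D : SaddleCurve c M η c₀) (w : ℝ) : ℝ :=
  ∑ p, D.kap * ((D.a p w + D.a p (-w)) / 2 - Real.log (sinhRatio (D.gap p w))) +
    (D.B w + D.B (-w)) / 2 * ∑ p, D.W p - w * D.rho * (D.B w - D.B (-w))

variable (D : SaddleCurve c M η c₀)

theorem W_nonneg (p : D.K) : 0 ≤ D.W p :=
  mul_nonneg D.kap_nonneg (sub_nonneg.2 (D.lam_le_gam p))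

theorem saddle_eq {w : ℝ} (hw : w ∈ Set.Icc (-c) c) :
    ∑ p, D.W p * (-(D.r p w)⁻¹ * (1 / 2 - hOne (D.gap p w))) =
      D.rho * w - (∑ p, D.W p) / 2 := D.saddle w hw

theorem gap_neg (p : D.K) (w : ℝ) : D.gap p (-w) = -D.gap p w := by simp [gap]

theorem F11_neg (w : ℝ) : D.F11 (-w) = D.F11 w := by
  simp only [F11, gap_neg, hTwo_neg, neg_neg]
  exact Finset.sum_congr rfl fun p _ => by ring

theorem hess_neg (w : ℝ) : D.hess (-w) = D.hess w := by
  simp only [hess, F11_neg, neg_neg]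
  ring

theorem energy_neg (w : ℝ) : D.energy (-w) = D.energy w := by
  simp only [energy, gap_neg, sinhRatio_neg, neg_neg, add_comm]
  ring

theorem gam_mul_exp (p : D.K) (w : ℝ) :
    D.gam p * Real.exp (D.lam p * D.B w) = D.lam p * D.r p w + (D.gam p - D.lam p) := by
  have := (D.lam_pos p).ne'
  simp only [r]
  field_simp
  ring

theorem r_pos (hη : 0 < η) (p : D.K) {w : ℝ} (hw : w ∈ Set.Icc (-c) c) : 0 < D.r p w :=
  hη.trans_le (D.le_r p w hw)

theorem gam_pos (p : D.K) : 0 < D.gam p := (D.lam_pos p).trans_le (D.lam_le_gam p)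

theorem hasDerivWithinAt_B {w : ℝ} (hw : w ∈ Set.Icc (-c) c) :
    HasDerivWithinAt D.B (derivIcc c D.B w) (Set.Icc (-c) c) w :=
  (D.differentiableOn_B w hw).hasDerivWithinAt

theorem hasDerivWithinAt_r (p : D.K) {w : ℝ} (hw : w ∈ Set.Icc (-c) c) :
    HasDerivWithinAt (D.r p)
      (D.gam p * Real.exp (D.lam p * D.B w) * derivIcc c D.B w) (Set.Icc (-c) c) w := by
  have h := (((((D.hasDerivWithinAt_B hw).const_mul (D.lam p)).exp.sub_const 1).div_const
    (D.lam p)).const_mul (D.gam p)).const_add 1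
  refine h.congr_deriv ?_
  have := (D.lam_pos p).ne'
  field_simp

theorem hasDerivWithinAt_a (hη : 0 < η) (p : D.K) {w : ℝ} (hw : w ∈ Set.Icc (-c) c) :
    HasDerivWithinAt (D.a p)
      (-((D.gam p - D.lam p) * (D.r p w)⁻¹ * derivIcc c D.B w)) (Set.Icc (-c) c) w := by
  have hr := D.r_pos hη p hw
  have h := ((D.hasDerivWithinAt_B hw).const_mul (D.lam p)).sub
    ((D.hasDerivWithinAt_r p hw).log hr.ne')
  refine h.congr_deriv ?_
  rw [D.gam_mul_exp]
  field_simp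
  ring

theorem neg_mem {w : ℝ} (hw : w ∈ Set.Icc (-c) c) : -w ∈ Set.Icc (-c) c :=
  ⟨by linarith [hw.2], by linarith [hw.1]⟩

theorem hasDerivWithinAt_gap (hη : 0 < η) (p : D.K) {w : ℝ} (hw : w ∈ Set.Icc (-c) c) :
    HasDerivWithinAt (D.gap p)
      (-((D.gam p - D.lam p) * ((D.r p w)⁻¹ * derivIcc c D.B w +
        (D.r p (-w))⁻¹ * derivIcc c D.B (-w)))) (Set.Icc (-c) c) w := by
  refine ((D.hasDerivWithinAt_a hη p hw).sub
    (D.hasDerivWithinAt_a hη p (neg_mem hw)).comp_neg_Icc).congr_deriv ?_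
  ring

theorem linear_system (hc : 0 < c) (hη : 0 < η) {w : ℝ} (hw : w ∈ Set.Icc (-c) c) :
    D.F20 w * derivIcc c D.B w - D.F11 w * derivIcc c D.B (-w) = D.rho := by
  have h1 : HasDerivWithinAt
      (fun w => ∑ p, D.W p * (-(D.r p w)⁻¹ * (1 / 2 - hOne (D.gap p w))))
      (D.F20 w * derivIcc c D.B w - D.F11 w * derivIcc c D.B (-w)) (Set.Icc (-c) c) w := by
    have hterm : ∀ p, HasDerivWithinAt
        (fun w => D.W p * (-(D.r p w)⁻¹ * (1 / 2 - hOne (D.gap p w)))) _ (Set.Icc (-c) c) w :=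
      fun p => ((((D.hasDerivWithinAt_r p hw).inv (D.r_pos hη p hw).ne').neg).mul
        (((hasDerivAt_hOne _).comp_hasDerivWithinAt w
          (D.hasDerivWithinAt_gap hη p hw)).const_sub (1 / 2))).const_mul (D.W p)
    refine (HasDerivWithinAt.fun_sum (u := Finset.univ) fun p _ => hterm p).congr_deriv ?_
    rw [F20, F11, Finset.sum_mul, Finset.sum_mul, ← Finset.sum_sub_distrib]
    refine Finset.sum_congr rfl fun p _ => ?_
    have hr := (D.r_pos hη p hw).ne'
    have hr' := (D.r_pos hη p (neg_mem hw)).ne'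
    simp only [Pi.inv_apply, Pi.neg_apply, Function.comp_apply]
    field_simp
    ring
  have h2 : HasDerivWithinAt
      (fun w => ∑ p, D.W p * (-(D.r p w)⁻¹ * (1 / 2 - hOne (D.gap p w))))
      D.rho (Set.Icc (-c) c) w := by
    have : HasDerivWithinAt (fun w => D.rho * w - (∑ p, D.W p) / 2) D.rho (Set.Icc (-c) c) w := by
      simpa using (((hasDerivAt_id w).const_mul D.rho).sub_const
        ((∑ p, D.W p) / 2)).hasDerivWithinAt
    exact this.congr (fun t ht => D.saddle_eq ht) (D.saddle_eq hw)
  exact (uniqueDiffOn_Icc (by linarith) w hw).eq_deriv _ h1 h2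

theorem derivIcc_B_mul_hess (hc : 0 < c) (hη : 0 < η) {w : ℝ} (hw : w ∈ Set.Icc (-c) c) :
    derivIcc c D.B w * D.hess w = D.rho * (D.F20 (-w) + D.F11 w) := by
  have h1 := D.linear_system hc hη hw
  have h2 := D.linear_system hc hη (neg_mem hw)
  rw [neg_neg, F11_neg] at h2
  rw [hess]
  linear_combination D.F20 (-w) * h1 + D.F11 w * h2

theorem hasDerivWithinAt_energy (hη : 0 < η) {w : ℝ} (hw : w ∈ Set.Icc (-c) c) :
    HasDerivWithinAt D.energy (-D.rho * (D.B w - D.B (-w))) (Set.Icc (-c) c) w := by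
  have hw' := neg_mem hw
  have hB := D.hasDerivWithinAt_B hw
  have hB' := (D.hasDerivWithinAt_B hw').comp_neg_Icc
  have hterm : ∀ p, HasDerivWithinAt
      (fun w => D.kap * ((D.a p w + D.a p (-w)) / 2 - Real.log (sinhRatio (D.gap p w))))
      _ (Set.Icc (-c) c) w :=
    fun p => ((((D.hasDerivWithinAt_a hη p hw).add
      (D.hasDerivWithinAt_a hη p hw').comp_neg_Icc).div_const 2).sub
      ((hasDerivAt_log_sinhRatio _).comp_hasDerivWithinAt w
        (D.hasDerivWithinAt_gap hη p hw))).const_mul D.kap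
  have h := ((HasDerivWithinAt.fun_sum (u := Finset.univ) fun p _ => hterm p).add
    (((hB.add hB').div_const 2).mul_const (∑ p, D.W p))).sub
      (((hasDerivWithinAt_id w (Set.Icc (-c) c)).mul_const D.rho).mul (hB.sub hB'))
  refine h.congr_deriv ?_
  have e1 := D.saddle_eq hw
  have e2 := D.saddle_eq hw'
  have key : ∑ p, D.kap * ((-((D.gam p - D.lam p) * (D.r p w)⁻¹ * derivIcc c D.B w) +
        -(-((D.gam p - D.lam p) * (D.r p (-w))⁻¹ * derivIcc c D.B (-w)))) / 2 -
      hOne (D.gap p w) * (-((D.gam p - D.lam p) * ((D.r p w)⁻¹ * derivIcc c D.B w +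
        (D.r p (-w))⁻¹ * derivIcc c D.B (-w))))) =
      derivIcc c D.B w * (D.rho * w - (∑ p, D.W p) / 2) -
        derivIcc c D.B (-w) * (D.rho * (-w) - (∑ p, D.W p) / 2) := by
    rw [← e1, ← e2, Finset.mul_sum, Finset.mul_sum, ← Finset.sum_sub_distrib]
    refine Finset.sum_congr rfl fun p _ => ?_
    rw [gap_neg, hOne_neg, W]
    ring
  rw [key]
  simp only [id, Pi.sub_apply, one_mul]
  ring

theorem rho_le_one : |D.rho| ≤ 1 := by
  have h : 2 * D.rho ^ 2 ≤ ∑ p, D.W p := by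
    rw [D.two_mul_rho_sq]
    refine Finset.sum_le_sum fun p _ => ?_
    have h1 := D.W_nonneg p
    have h2 := D.lam_le_gam p
    have h3 := D.gam_le_one p
    change D.W p * _ ≤ D.W p
    nlinarith
  have h2 : ∑ p, D.W p ≤ 1 := D.sum_le_one
  rw [abs_le]
  constructor <;> nlinarith

theorem rho_pos (hc₀ : 0 < c₀) : 0 < D.rho := by
  refine lt_of_le_of_ne D.rho_nonneg fun h0 => ?_
  have h := D.two_mul_rho_sq
  have h1 : (∑ p, D.W p * D.gam p) / 3 ≤
      ∑ p, D.kap * (D.gam p - D.lam p) * (D.gam p / 2 - (D.gam p - D.lam p) / 6) := by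
    rw [Finset.sum_div]
    refine Finset.sum_le_sum fun p _ => ?_
    have h1 := D.W_nonneg p
    have h2 := D.lam_pos p
    change _ ≤ D.W p * _
    nlinarith
  have h2 : c₀ ≤ ∑ p, D.W p * D.gam p := D.le_sum
  rw [← h, ← h0] at h1
  linarith

theorem r_zero (p : D.K) : D.r p 0 = 1 := by simp [r, D.B_zero]

theorem gap_zero (p : D.K) : D.gap p 0 = 0 := by simp [gap]

theorem F20_sub_F11_zero : D.F20 0 - D.F11 0 = 2 * D.rho ^ 2 := by
  rw [D.two_mul_rho_sq, F20, F11, ← Finset.sum_sub_distrib]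
  refine Finset.sum_congr rfl fun p _ => ?_
  simp only [neg_zero, r_zero, gap_zero, hOne_zero, hTwo_zero, D.B_zero, mul_zero, Real.exp_zero, W]
  ring

theorem derivIcc_B_zero (hc : 0 < c) (hη : 0 < η) (hc₀ : 0 < c₀) :
    D.rho * derivIcc c D.B 0 = 1 / 2 := by
  have h := D.linear_system hc hη (w := 0) ⟨by linarith, hc.le⟩
  rw [neg_zero, ← sub_mul, F20_sub_F11_zero] at h
  have hρ := (D.rho_pos hc₀).ne'
  have : D.rho * (D.rho * derivIcc c D.B 0) = D.rho * (1 / 2) := by linarith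
  exact mul_left_cancel₀ hρ this

end SaddleCurve

namespace SaddleCurve

variable {c M η c₀ : ℝ} {n : ℕ}

theorem abs_lam_le (D : SaddleCurve c M η c₀) (p : D.K) : |D.lam p| ≤ 1 := by
  rw [abs_of_pos (D.lam_pos p)]
  exact (D.lam_le_gam p).trans (D.gam_le_one p)

theorem abs_gam_le (D : SaddleCurve c M η c₀) (p : D.K) : |D.gam p| ≤ 1 := by
  rw [abs_of_pos (D.gam_pos p)]
  exact D.gam_le_one p

theorem abs_gam_sub_lam_le (D : SaddleCurve c M η c₀) (p : D.K) : |D.gam p - D.lam p| ≤ 1 := by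
  rw [abs_of_nonneg (sub_nonneg.2 (D.lam_le_gam p))]
  linarith [D.lam_pos p, D.gam_le_one p]

/-- The family of all curves with the given parameters has uniformly bounded derivatives
up to order `n`. -/
def Regular (c M η c₀ : ℝ) (n : ℕ) : Prop :=
  UnifSmooth c n (fun D : SaddleCurve c M η c₀ => D.B)

theorem unifSmooth_exp (h : Regular c M η c₀ n) :
    UnifSmooth c n (fun (q : Σ D : SaddleCurve c M η c₀, D.K) w =>
      Real.exp (q.1.lam q.2 * q.1.B w)) :=
  ((h.reindex (fun q : Σ D : SaddleCurve c M η c₀, D.K => q.1)).const_mul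
    (a := fun q => q.1.lam q.2) 1 (fun q => q.1.abs_lam_le q.2)).comp_contDiff Real.contDiff_exp

theorem unifBdd_r : UnifBdd c (fun (q : Σ D : SaddleCurve c M η c₀, D.K) => q.1.r q.2) := by
  refine ⟨1 + |M| * Real.exp |M|, ?_⟩
  rintro ⟨D, p⟩ w hw
  have hl := D.lam_pos p
  have hB : |D.B w| ≤ |M| := (D.abs_B_le w hw).trans (le_abs_self M)
  have h1 : |D.lam p * D.B w| ≤ D.lam p * |M| := by
    rw [abs_mul, abs_of_pos hl]
    exact mul_le_mul_of_nonneg_left hB hl.le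
  have h2 : |D.lam p * D.B w| ≤ |M| := by
    have := D.abs_lam_le p
    rw [abs_mul]
    nlinarith [abs_nonneg (D.B w), abs_nonneg M]
  have h3 : |(Real.exp (D.lam p * D.B w) - 1) / D.lam p| ≤ |M| * Real.exp |M| := by
    rw [abs_div, abs_of_pos hl, div_le_iff₀ hl]
    calc _ ≤ _ := abs_exp_sub_one_le_mul_exp _
      _ ≤ (D.lam p * |M|) * Real.exp |M| :=
        mul_le_mul h1 (Real.exp_le_exp.2 h2) (Real.exp_pos _).le (by positivity)
      _ = _ := by ring
  change |1 + _| ≤ _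
  refine (abs_add_le _ _).trans ?_
  rw [abs_one, abs_mul]
  have h4 := D.abs_gam_le p
  nlinarith [abs_nonneg ((Real.exp (D.lam p * D.B w) - 1) / D.lam p), abs_nonneg (D.gam p)]

theorem unifSmooth_r (hc : 0 < c) (h : Regular c M η c₀ n) :
    UnifSmooth c n (fun (q : Σ D : SaddleCurve c M η c₀, D.K) => q.1.r q.2) := by
  cases n with
  | zero => exact unifBdd_r
  | succ n =>
    refine ⟨unifBdd_r, fun q w => q.1.gam q.2 * (Real.exp (q.1.lam q.2 * q.1.B w) *
      derivIcc c q.1.B w), fun q w hw => ?_, ?_⟩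
    · simpa only [mul_assoc] using q.1.hasDerivWithinAt_r q.2 hw
    · have h1 := unifSmooth_exp (UnifSmooth.of_succ h)
      have h2 := (UnifSmooth.derivIcc hc h).2
      exact (h1.mul (h2.reindex (fun q : Σ D : SaddleCurve c M η c₀, D.K => q.1))).const_mul
        (a := fun q => q.1.gam q.2) 1 (fun q => q.1.abs_gam_le q.2)

theorem unifSmooth_inv_r (hc : 0 < c) (hη : 0 < η) (h : Regular c M η c₀ n) :
    UnifSmooth c n (fun (q : Σ D : SaddleCurve c M η c₀, D.K) w => (q.1.r q.2 w)⁻¹) :=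
  (unifSmooth_r hc h).inv hη (fun q w hw => q.1.le_r q.2 w hw)

theorem unifSmooth_gap (hc : 0 < c) (hη : 0 < η) (h : Regular c M η c₀ n) :
    UnifSmooth c n (fun (q : Σ D : SaddleCurve c M η c₀, D.K) => q.1.gap q.2) := by
  have ha : UnifSmooth c n (fun (q : Σ D : SaddleCurve c M η c₀, D.K) => q.1.a q.2) :=
    ((h.reindex (fun q : Σ D : SaddleCurve c M η c₀, D.K => q.1)).const_mul
      (a := fun q => q.1.lam q.2) 1 (fun q => q.1.abs_lam_le q.2)).sub
      ((unifSmooth_r hc h).log hη (fun q w hw => q.1.le_r q.2 w hw))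
  exact ha.sub ha.comp_neg

theorem unifSmooth_F20 (hc : 0 < c) (hη : 0 < η) (h : Regular c M η c₀ n) :
    UnifSmooth c n (fun (D : SaddleCurve c M η c₀) => D.F20) := by
  have hr := unifSmooth_inv_r hc hη h
  have hg := unifSmooth_gap hc hη h
  refine UnifSmooth.weighted_sum (κ := fun D : SaddleCurve c M η c₀ => D.K)
    (W := fun D => D.W) (fun D => D.W_nonneg) (fun D => D.sum_le_one)
    (Φ := fun q w => (q.1.r q.2 w)⁻¹ * (q.1.r q.2 w)⁻¹ *
    (q.1.gam q.2 * Real.exp (q.1.lam q.2 * q.1.B w) * (1 / 2 - hOne (q.1.gap q.2 w)) -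
      (q.1.gam q.2 - q.1.lam q.2) * hTwo (q.1.gap q.2 w))) ?_
  exact (hr.mul hr).mul
    ((((unifSmooth_exp h).const_mul (a := fun q => q.1.gam q.2) 1
        (fun q => q.1.abs_gam_le q.2)).mul
      ((UnifSmooth.const (a := fun _ => (1 / 2 : ℝ)) |1 / 2| (fun _ => le_rfl)).sub
        (hg.comp_contDiff contDiff_hOne))).sub
      ((hg.comp_contDiff contDiff_hTwo).const_mul (a := fun q => q.1.gam q.2 - q.1.lam q.2) 1
        (fun q => q.1.abs_gam_sub_lam_le q.2)))

theorem unifSmooth_F11 (hc : 0 < c) (hη : 0 < η) (h : Regular c M η c₀ n) :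
    UnifSmooth c n (fun (D : SaddleCurve c M η c₀) => D.F11) := by
  have hr := unifSmooth_inv_r hc hη h
  have hg := unifSmooth_gap hc hη h
  refine UnifSmooth.weighted_sum (κ := fun D : SaddleCurve c M η c₀ => D.K)
    (W := fun D => D.W) (fun D => D.W_nonneg) (fun D => D.sum_le_one)
    (Φ := fun q w => (q.1.r q.2 w)⁻¹ * (q.1.r q.2 (-w))⁻¹ *
      ((q.1.gam q.2 - q.1.lam q.2) * hTwo (q.1.gap q.2 w))) ?_
  exact (hr.mul hr.comp_neg).mul
      ((hg.comp_contDiff contDiff_hTwo).const_mul (a := fun q => q.1.gam q.2 - q.1.lam q.2) 1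
        (fun q => q.1.abs_gam_sub_lam_le q.2))

theorem unifSmooth_hess (hc : 0 < c) (hη : 0 < η) (h : Regular c M η c₀ n) :
    UnifSmooth c n (fun (D : SaddleCurve c M η c₀) => D.hess) := by
  have h1 := unifSmooth_F20 hc hη h
  have h2 := unifSmooth_F11 hc hη h
  exact ((h1.mul h1.comp_neg).sub (h2.mul h2)).congr fun D w _ => by simp only [hess, sq]

theorem regular_zero : Regular c M η c₀ 0 := ⟨M, fun D => D.abs_B_le⟩

theorem exists_form_ge (hc : 0 < c) (hη : 0 < η) (hc₀ : 0 < c₀) :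
    ∃ m : ℝ, 0 < m ∧ ∀ D : SaddleCurve c M η c₀, ∀ w ∈ Set.Icc (-c) c, ∀ s t : ℝ,
      m * (s ^ 2 + t ^ 2) ≤ D.F20 w * s ^ 2 + 2 * D.F11 w * s * t + D.F20 (-w) * t ^ 2 := by
  obtain ⟨G, hG⟩ := (unifSmooth_gap hc hη (regular_zero (c := c) (M := M) (η := η)
    (c₀ := c₀))).unifBdd
  obtain ⟨R₀, hR₀⟩ := unifBdd_r (c := c) (M := M) (η := η) (c₀ := c₀)
  obtain ⟨θ, hθ, hform⟩ := exists_quadraticForm_ge G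
  set R := max R₀ 1
  have hR1 : 1 ≤ R := le_max_right _ _
  have hR : 0 < R := by linarith
  refine ⟨θ / R ^ 2 * c₀, by positivity, fun D w hw s t => ?_⟩
  have hterm : ∀ p, D.W p * D.gam p * (θ / R ^ 2 * (s ^ 2 + t ^ 2)) ≤
      D.W p * ((D.r p w)⁻¹ * (D.r p w)⁻¹ *
        (D.gam p * Real.exp (D.lam p * D.B w) * (1 / 2 - hOne (D.gap p w)) -
          (D.gam p - D.lam p) * hTwo (D.gap p w))) * s ^ 2 +
      2 * (D.W p * ((D.r p w)⁻¹ * (D.r p (-w))⁻¹ *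
        ((D.gam p - D.lam p) * hTwo (D.gap p w)))) * s * t +
      D.W p * ((D.r p (-w))⁻¹ * (D.r p (-w))⁻¹ *
        (D.gam p * Real.exp (D.lam p * D.B (-w)) * (1 / 2 - hOne (D.gap p (-w))) -
          (D.gam p - D.lam p) * hTwo (D.gap p (-w)))) * t ^ 2 := by
    intro p
    have hw' := neg_mem hw
    obtain ⟨h1, h2, h3⟩ := hform _ (hG ⟨D, p⟩ w hw)
    simp only at h1 h2 h3
    have hr := D.r_pos hη p hw
    have hr' := D.r_pos hη p hw'
    have hrR : D.r p w ≤ R :=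
      ((le_abs_self _).trans (hR₀ ⟨D, p⟩ w hw)).trans (le_max_left _ _)
    have hrR' : D.r p (-w) ≤ R :=
      ((le_abs_self _).trans (hR₀ ⟨D, p⟩ (-w) hw')).trans (le_max_left _ _)
    rw [gam_mul_exp, gam_mul_exp, gap_neg, hOne_neg, hTwo_neg]
    have hq : R⁻¹ ≤ (D.r p w)⁻¹ := inv_anti₀ hr hrR
    have hq' : R⁻¹ ≤ (D.r p (-w))⁻¹ := inv_anti₀ hr' hrR'
    have hqr : (D.r p w)⁻¹ * D.r p w = 1 := inv_mul_cancel₀ hr.ne'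
    have hqr' : (D.r p (-w))⁻¹ * D.r p (-w) = 1 := inv_mul_cancel₀ hr'.ne'
    have hRR : (θ / R ^ 2) = θ * (R⁻¹) ^ 2 := by rw [inv_pow, div_eq_mul_inv]
    have hRi : 0 < R⁻¹ := inv_pos.2 hR
    have hRi1 : R⁻¹ ≤ 1 := inv_le_one_of_one_le₀ hR1
    rw [hRR]
    generalize R⁻¹ = ρ at *
    generalize (D.r p w)⁻¹ = q at *
    generalize (D.r p (-w))⁻¹ = q' at *
    generalize D.r p w = r at *
    generalize D.r p (-w) = r' at *
    generalize D.gap p w = x at *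
    have hl := D.lam_pos p
    have he := sub_nonneg.2 (D.lam_le_gam p)
    have hgl : D.gam p = D.lam p + (D.gam p - D.lam p) := by ring
    generalize D.gam p - D.lam p = e at *
    have hW := D.W_nonneg p
    rw [hgl]
    generalize D.W p = W at *
    generalize D.lam p = l at *
    have e1 : W * (q * q * ((l * r + e) * (1 / 2 - hOne x) - e * hTwo x)) * s ^ 2 +
        2 * (W * (q * q' * (e * hTwo x))) * s * t +
        W * (q' * q' * ((l * r' + e) * (1 / 2 - -hOne x) - e * hTwo x)) * t ^ 2 =
        W * (l * ((q * r) * q * (1 / 2 - hOne x) * s ^ 2 +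
          (q' * r') * q' * (1 / 2 + hOne x) * t ^ 2) +
          e * ((1 / 2 - hOne x) * (q * s) ^ 2 + (1 / 2 + hOne x) * (q' * t) ^ 2 -
            hTwo x * (q * s - q' * t) ^ 2)) := by ring
    rw [e1, hqr, hqr', mul_assoc]
    refine mul_le_mul_of_nonneg_left ?_ hW
    rw [add_mul]
    have hs := sq_nonneg s
    have ht := sq_nonneg t
    have hρ2 : ρ ^ 2 ≤ ρ := by nlinarith
    refine add_le_add (mul_le_mul_of_nonneg_left ?_ hl.le) (mul_le_mul_of_nonneg_left ?_ he)
    · have a1 : ρ ^ 2 * θ ≤ q * (1 / 2 - hOne x) :=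
        mul_le_mul (hρ2.trans hq) h1 hθ.le (hRi.trans_le hq).le
      have a2 : ρ ^ 2 * θ ≤ q' * (1 / 2 + hOne x) :=
        mul_le_mul (hρ2.trans hq') h2 hθ.le (hRi.trans_le hq').le
      nlinarith [mul_le_mul_of_nonneg_right a1 hs, mul_le_mul_of_nonneg_right a2 ht]
    · refine le_trans ?_ (h3 (q * s) (q' * t))
      have a1 : ρ ^ 2 ≤ q ^ 2 := pow_le_pow_left₀ hRi.le hq 2
      have a2 : ρ ^ 2 ≤ q' ^ 2 := pow_le_pow_left₀ hRi.le hq' 2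
      rw [mul_assoc]
      refine mul_le_mul_of_nonneg_left ?_ hθ.le
      nlinarith [mul_le_mul_of_nonneg_right a1 hs, mul_le_mul_of_nonneg_right a2 ht]
  have hsum := Finset.sum_le_sum fun p (_ : p ∈ Finset.univ) => hterm p
  rw [← Finset.sum_mul, Finset.sum_add_distrib, Finset.sum_add_distrib] at hsum
  simp only [← Finset.sum_mul, ← Finset.mul_sum] at hsum
  refine le_trans ?_ hsum
  have h5 : c₀ ≤ ∑ p, D.W p * D.gam p := D.le_sum
  have h6 : 0 ≤ θ / R ^ 2 * (s ^ 2 + t ^ 2) := by positivity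
  calc _ = c₀ * (θ / R ^ 2 * (s ^ 2 + t ^ 2)) := by ring
    _ ≤ _ := mul_le_mul_of_nonneg_right h5 h6

theorem exists_hess_ge (hc : 0 < c) (hη : 0 < η) (hc₀ : 0 < c₀) :
    ∃ m : ℝ, 0 < m ∧ ∀ D : SaddleCurve c M η c₀, ∀ w ∈ Set.Icc (-c) c, m ≤ D.hess w := by
  obtain ⟨m, hm, h⟩ := exists_form_ge (M := M) hc hη hc₀
  refine ⟨m ^ 2, by positivity, fun D w hw => ?_⟩
  have h1 := h D w hw 1 0
  have h2 := h D w hw (-D.F11 w) (D.F20 w)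
  have h3 : m ≤ D.F20 w := by linarith
  have h4 : D.F20 w * (m * D.F20 w) ≤ D.F20 w * D.hess w := by
    rw [hess]
    nlinarith [sq_nonneg (D.F11 w)]
  have h5 := le_of_mul_le_mul_left h4 (hm.trans_le h3)
  nlinarith

theorem regular (hc : 0 < c) (hη : 0 < η) (hc₀ : 0 < c₀) (n : ℕ) : Regular c M η c₀ n := by
  induction n with
  | zero => exact regular_zero
  | succ n ih =>
    refine ⟨regular_zero, fun D => derivIcc c D.B, fun D w hw => D.hasDerivWithinAt_B hw, ?_⟩
    obtain ⟨m, hm, hmh⟩ := exists_hess_ge (M := M) hc hη hc₀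
    refine ((((unifSmooth_F20 hc hη ih).comp_neg.add (unifSmooth_F11 hc hη ih)).const_mul
      (a := fun D => D.rho) 1 (fun D => D.rho_le_one)).mul
      ((unifSmooth_hess hc hη ih).inv hm hmh)).congr fun D w hw => ?_
    rw [← D.derivIcc_B_mul_hess hc hη hw,
      mul_inv_cancel_right₀ (hm.trans_le (hmh D w hw)).ne']

theorem derivIcc_energy_sub (hc : 0 < c) (hη : 0 < η) (D : SaddleCurve c M η c₀) {w : ℝ}
    (hw : w ∈ Set.Icc (-c) c) :
    derivIcc c (fun w => D.energy w - D.energy 0) w = -D.rho * (D.B w - D.B (-w)) :=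
  ((D.hasDerivWithinAt_energy hη hw).sub_const _).derivWithin
    (uniqueDiffOn_Icc (by linarith) w hw)

theorem unifSmooth_energy_sub (hc : 0 < c) (hη : 0 < η) (hc₀ : 0 < c₀) (n : ℕ) :
    UnifSmooth c n (fun (D : SaddleCurve c M η c₀) w => D.energy w - D.energy 0) := by
  have hd : ∀ n, UnifSmooth c n
      (fun (D : SaddleCurve c M η c₀) w => -D.rho * (D.B w - D.B (-w))) := fun n =>
    (UnifSmooth.sub (regular hc hη hc₀ n) (UnifSmooth.comp_neg (regular hc hη hc₀ n))).const_mul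
      (a := fun D => -D.rho) 1 (fun D => by rw [abs_neg]; exact D.rho_le_one)
  refine UnifSmooth.of_succ ⟨?_, _, fun D w hw => (D.hasDerivWithinAt_energy hη hw).sub_const _,
    hd n⟩
  obtain ⟨C, hC⟩ := hd 0
  have h0 : (0 : ℝ) ∈ Set.Icc (-c) c := ⟨by linarith, hc.le⟩
  refine ⟨C * c, fun D w hw => ?_⟩
  have h1 := (convex_Icc (-c) c).norm_image_sub_le_of_norm_hasDerivWithin_le
    (fun w hw => D.hasDerivWithinAt_energy hη hw) (fun w hw => hC D w hw) h0 hw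
  rw [Real.norm_eq_abs, Real.norm_eq_abs, sub_zero] at h1
  have hC0 : 0 ≤ C := (abs_nonneg _).trans (hC D 0 h0)
  exact h1.trans (mul_le_mul_of_nonneg_left (abs_le.2 hw) hC0)

theorem iterate_two_derivIcc_energy_sub (hc : 0 < c) (hη : 0 < η) (hc₀ : 0 < c₀)
    (D : SaddleCurve c M η c₀) :
    ((derivIcc c)^[2] (fun w => D.energy w - D.energy 0)) 0 = -1 := by
  have h0 : (0 : ℝ) ∈ Set.Icc (-c) c := ⟨by linarith, hc.le⟩
  have h0' : -(0 : ℝ) ∈ Set.Icc (-c) c := neg_mem h0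
  change derivWithin (derivIcc c (fun w => D.energy w - D.energy 0)) (Set.Icc (-c) c) 0 = -1
  rw [derivWithin_congr (fun w hw => D.derivIcc_energy_sub hc hη hw)
    (D.derivIcc_energy_sub hc hη h0)]
  have h := (((D.hasDerivWithinAt_B h0).sub
    (D.hasDerivWithinAt_B h0').comp_neg_Icc).const_mul (-D.rho)).derivWithin
    (uniqueDiffOn_Icc (by linarith) 0 h0)
  have h2 := D.derivIcc_B_zero hc hη hc₀
  refine h.trans ?_
  rw [neg_zero]
  linarith

theorem exists_expansion (hc : 0 < c) (hη : 0 < η) (hc₀ : 0 < c₀) :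
    ∃ Cj : ℕ → ℝ, ∃ Ck : ℕ → ℝ, ∃ C : ℝ,
      (∀ j, 0 < Cj j) ∧ (∀ k, 0 < Ck k) ∧ 0 < C ∧ ∀ D : SaddleCurve c M η c₀, ∃ b : ℕ → ℝ,
        b 0 = -(1 / 2) ∧ (∀ j, |b j| ≤ Cj j) ∧
        (∀ k, ∀ w ∈ Set.Icc (-c) c, |D.energy w - D.energy 0 -
          ∑ j ∈ Finset.range k, b j * w ^ (2 * j + 2)| ≤ Ck k * w ^ (2 * k + 2)) ∧
        ∀ w ∈ Set.Icc (-c) c, |D.hess w - D.hess 0| ≤ C * w ^ 2 * D.hess 0 := by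
  have h0 : (0 : ℝ) ∈ Set.Icc (-c) c := ⟨by linarith, hc.le⟩
  have hE := unifSmooth_energy_sub (M := M) hc hη hc₀
  choose A hA using fun n => (hE n).exists_abs_iterate_derivIcc_le hc
  choose T hT using fun k => (hE (2 * (k + 1))).exists_taylor_even hc (k + 1)
    (fun D w _ => by rw [D.energy_neg])
  obtain ⟨H, hH⟩ := (unifSmooth_hess hc hη (regular hc hη hc₀ (2 * 1))).exists_taylor_even hc 1
    (fun (D : SaddleCurve c M η c₀) w _ => D.hess_neg w)
  obtain ⟨m, hm, hmh⟩ := exists_hess_ge (M := M) hc hη hc₀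
  refine ⟨fun j => |A (2 * j + 2)| + 1, fun k => |T k| + 1, |H| / m + 1, fun j => by positivity,
    fun k => by positivity, by positivity, fun D => ⟨fun j =>
      ((derivIcc c)^[2 * j + 2] (fun w => D.energy w - D.energy 0)) 0 / (2 * j + 2).factorial,
      ?_, fun j => ?_, fun k w hw => ?_, fun w hw => ?_⟩⟩
  · simp only [mul_zero, zero_add]
    rw [D.iterate_two_derivIcc_energy_sub hc hη hc₀]
    norm_num
  · rw [abs_div, Nat.abs_cast]
    have h1 : (1 : ℝ) ≤ (2 * j + 2).factorial := by exact_mod_cast Nat.factorial_pos _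
    refine (div_le_self (abs_nonneg _) h1).trans ?_
    linarith [hA (2 * j + 2) D, le_abs_self (A (2 * j + 2))]
  · have h1 := hT k D w hw
    rw [Finset.sum_range_succ'] at h1
    simp only [mul_zero, Function.iterate_zero, id, sub_self, zero_div, zero_mul, add_zero,
      mul_add, mul_one] at h1
    refine h1.trans (mul_le_mul_of_nonneg_right (by linarith [le_abs_self (T k)]) ?_)
    rw [show 2 * k + 2 = 2 * (k + 1) by ring, pow_mul]
    positivity
  · have h1 := hH D w hw
    simp only [Finset.sum_range_one, mul_zero, Function.iterate_zero, id, Nat.factorial_zero,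
      Nat.cast_one, div_one, pow_zero, mul_one] at h1
    refine h1.trans ?_
    have h2 := hmh D 0 h0
    have h3 : |H| ≤ |H| / m * D.hess 0 := by
      rw [div_mul_eq_mul_div, le_div_iff₀ hm]
      exact mul_le_mul_of_nonneg_left h2 (abs_nonneg _)
    have h4 : H ≤ (|H| / m + 1) * D.hess 0 := by linarith [le_abs_self H]
    calc H * w ^ 2 ≤ (|H| / m + 1) * D.hess 0 * w ^ 2 :=
          mul_le_mul_of_nonneg_right h4 (sq_nonneg w)
      _ = _ := by ring

end SaddleCurve

theorem gfun_eq_log_sinhRatioC {z : ℂ} (hz : z ≠ 0) :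
    gfun z = Complex.log (sinhRatioC (Complex.log z)) := by
  rcases eq_or_ne z 1 with rfl | h1
  · simp [gfun, sinhRatioC_zero]
  have hl : Complex.log z ≠ 0 := by
    intro h
    exact h1 (by rw [← Complex.exp_log hz, h, Complex.exp_zero])
  have h2 : z ^ (2⁻¹ : ℂ) - z ^ (-2⁻¹ : ℂ) = Complex.log z * sinhRatioC (Complex.log z) := by
    rw [mul_sinhRatioC, Complex.cpow_def_of_ne_zero hz, Complex.cpow_def_of_ne_zero hz,
      Complex.sinh, show -(Complex.log z / 2) = Complex.log z * -2⁻¹ by ring,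
      show Complex.log z / 2 = Complex.log z * 2⁻¹ by ring]
    ring
  rw [gfun, if_neg h1, h2, mul_div_cancel_left₀ _ hl]

/-- The logarithm `-log(1 - p^{-s})` of an Euler factor. -/
def eulerLogC (p : ℕ) (s : ℂ) : ℂ := -Complex.log (1 - (p : ℂ) ^ (-s))

/-- The derivative of `eulerLogC p`. -/
def eulerLogC' (p : ℕ) (s : ℂ) : ℂ := -(Complex.log p / ((p : ℂ) ^ s - 1))

/-- The second derivative of `eulerLogC p`. -/
def eulerLogC'' (p : ℕ) (s : ℂ) : ℂ :=
  Complex.log p ^ 2 * (p : ℂ) ^ s / ((p : ℂ) ^ s - 1) ^ 2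

theorem norm_natCast_cpow_neg_lt_one {p : ℕ} (hp : 2 ≤ p) {s : ℂ} (hs : 0 < s.re) :
    ‖(p : ℂ) ^ (-s)‖ < 1 := by
  rw [Complex.norm_natCast_cpow_of_pos (by omega)]
  exact Real.rpow_lt_one_of_one_lt_of_neg (by exact_mod_cast hp) (by simpa using hs)

theorem one_sub_re_pos {p : ℕ} (hp : 2 ≤ p) {s : ℂ} (hs : 0 < s.re) :
    0 < (1 - (p : ℂ) ^ (-s)).re := by
  have h1 := norm_natCast_cpow_neg_lt_one hp hs
  have h2 := (Complex.abs_re_le_norm ((p : ℂ) ^ (-s)))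
  have h3 := le_abs_self ((p : ℂ) ^ (-s)).re
  simp only [Complex.sub_re, Complex.one_re]
  linarith

theorem natCast_cpow_ne_zero {p : ℕ} (hp : 2 ≤ p) (s : ℂ) : (p : ℂ) ^ s ≠ 0 := by
  have : (p : ℂ) ≠ 0 := by exact_mod_cast (by omega : p ≠ 0)
  simp [Complex.cpow_eq_zero_iff, this]

theorem natCast_cpow_sub_one_ne_zero {p : ℕ} (hp : 2 ≤ p) {s : ℂ} (hs : 0 < s.re) :
    (p : ℂ) ^ s - 1 ≠ 0 := by
  intro h
  have h1 := one_sub_re_pos hp hs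
  rw [Complex.cpow_neg, sub_eq_zero.1 h] at h1
  simp at h1

theorem hasDerivAt_natCast_cpow {p : ℕ} (hp : 2 ≤ p) (s : ℂ) :
    HasDerivAt (fun s : ℂ => (p : ℂ) ^ s) ((p : ℂ) ^ s * Complex.log p) s := by
  have hp0 : (p : ℂ) ≠ 0 := by exact_mod_cast (by omega : p ≠ 0)
  simpa using (hasDerivAt_id s).const_cpow (c := (p : ℂ)) (Or.inl hp0)

theorem hasDerivAt_eulerLogC {p : ℕ} (hp : 2 ≤ p) {s : ℂ} (hs : 0 < s.re) :
    HasDerivAt (eulerLogC p) (eulerLogC' p s) s := by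
  have h1 := (((hasDerivAt_natCast_cpow hp (-s)).comp s (hasDerivAt_neg s)).const_sub 1).clog
    (Or.inl (one_sub_re_pos hp hs))
  refine h1.neg.congr_deriv ?_
  have h2 := natCast_cpow_ne_zero hp s
  have h3 := natCast_cpow_sub_one_ne_zero hp hs
  simp only [Function.comp_def, eulerLogC', Complex.cpow_neg]
  have h4 : 1 - ((p : ℂ) ^ s)⁻¹ = ((p : ℂ) ^ s - 1) / (p : ℂ) ^ s := by field_simp
  rw [h4]
  field_simp

theorem hasDerivAt_eulerLogC' {p : ℕ} (hp : 2 ≤ p) {s : ℂ} (hs : 0 < s.re) :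
    HasDerivAt (eulerLogC' p) (eulerLogC'' p s) s := by
  have h3 := natCast_cpow_sub_one_ne_zero hp hs
  have h1 := ((hasDerivAt_const s (Complex.log p)).div
    ((hasDerivAt_natCast_cpow hp s).sub_const 1) h3).neg
  refine h1.congr_deriv ?_
  simp only [eulerLogC'']
  ring

/-- The first derivative of `log ∘ sinhRatioC`. -/
def hOneC (z : ℂ) : ℂ := deriv sinhRatioC z / sinhRatioC z

/-- The second derivative of `log ∘ sinhRatioC`. -/
def hTwoC (z : ℂ) : ℂ := deriv (deriv sinhRatioC) z / sinhRatioC z - hOneC z ^ 2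

theorem hasDerivAt_log_sinhRatioC {z : ℂ} (hz : sinhRatioC z ∈ Complex.slitPlane) :
    HasDerivAt (fun z => Complex.log (sinhRatioC z)) (hOneC z) z :=
  (differentiable_sinhRatioC z).hasDerivAt.clog hz

theorem hasDerivAt_hOneC {z : ℂ} (hz : sinhRatioC z ∈ Complex.slitPlane) :
    HasDerivAt hOneC (hTwoC z) z := by
  have h0 := Complex.slitPlane_ne_zero hz
  refine ((differentiable_deriv_sinhRatioC z).hasDerivAt.div
    (differentiable_sinhRatioC z).hasDerivAt h0).congr_deriv ?_
  simp only [hTwoC, hOneC]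
  field_simp

theorem Xi_cpow_eq {p : ℕ} (hp : 2 ≤ p) {s w : ℂ} (hs : 0 < s.re) (hw : 0 < w.re) :
    Xi ((p : ℂ) ^ (-s)) ((p : ℂ) ^ (-w)) = (eulerLogC p s + eulerLogC p w) / 2 -
      Complex.log (sinhRatioC (eulerLogC p s - eulerLogC p w)) := by
  have h1 := one_sub_re_pos hp hs
  have h2 := one_sub_re_pos hp hw
  have n1 : (1 - (p : ℂ) ^ (-s)) ≠ 0 := fun h => by simp [h] at h1
  have n2 : (1 - (p : ℂ) ^ (-w)) ≠ 0 := fun h => by simp [h] at h2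
  have a1 := Complex.abs_arg_lt_pi_div_two_iff.2 (Or.inl h1)
  have a2 := Complex.abs_arg_lt_pi_div_two_iff.2 (Or.inl h2)
  rw [abs_lt] at a1 a2
  have hlog : Complex.log ((1 - (p : ℂ) ^ (-s)) / (1 - (p : ℂ) ^ (-w))) =
      -(eulerLogC p s - eulerLogC p w) := by
    have e : -(eulerLogC p s - eulerLogC p w) =
        Complex.log (1 - (p : ℂ) ^ (-s)) - Complex.log (1 - (p : ℂ) ^ (-w)) := by
      simp only [eulerLogC]; ring
    rw [e, ← Complex.log_exp (x := Complex.log _ - Complex.log _), Complex.exp_sub,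
      Complex.exp_log n1, Complex.exp_log n2]
    · simp only [Complex.sub_im, Complex.log_im]
      linarith
    · simp only [Complex.sub_im, Complex.log_im]
      linarith
  rw [Xi, gfun_eq_log_sinhRatioC (div_ne_zero n1 n2), hlog, sinhRatioC_neg]
  simp only [eulerLogC]
  ring

/-- The points around which `fy y` is given by the principal branch of
`log (sinhRatioC (eulerLogC p s - eulerLogC p w))`. -/
def RegularPoint (y : ℝ) (s w : ℂ) : Prop :=
  0 < s.re ∧ 0 < w.re ∧
    ∀ p ∈ primesLe y, sinhRatioC (eulerLogC p s - eulerLogC p w) ∈ Complex.slitPlane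

theorem two_le_of_mem_primesLe {y : ℝ} {p : ℕ} (hp : p ∈ primesLe y) : 2 ≤ p :=
  (Finset.mem_filter.1 hp).2.two_le

theorem RegularPoint.swap {y : ℝ} {s w : ℂ} (h : RegularPoint y s w) : RegularPoint y w s := by
  refine ⟨h.2.1, h.1, fun p hp => ?_⟩
  rw [← neg_sub, sinhRatioC_neg]
  exact h.2.2 p hp

theorem RegularPoint.eventually_left {y : ℝ} {s w : ℂ} (h : RegularPoint y s w) :
    ∀ᶠ z in nhds s, RegularPoint y z w := by
  have h1 : ∀ᶠ z : ℂ in nhds s, 0 < z.re :=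
    (isOpen_lt continuous_const Complex.continuous_re).mem_nhds h.1
  have h2 : ∀ᶠ z : ℂ in nhds s, ∀ p ∈ primesLe y,
      sinhRatioC (eulerLogC p z - eulerLogC p w) ∈ Complex.slitPlane := by
    rw [Filter.eventually_all_finset]
    intro p hp
    have hc : ContinuousAt (fun z => sinhRatioC (eulerLogC p z - eulerLogC p w)) s :=
      (differentiable_sinhRatioC.continuous.continuousAt).comp
        ((hasDerivAt_eulerLogC (two_le_of_mem_primesLe hp) h.1).continuousAt.sub
          continuousAt_const)
    exact hc (Complex.isOpen_slitPlane.mem_nhds (h.2.2 p hp))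
  filter_upwards [h1, h2] with z hz1 hz2
  exact ⟨hz1, h.2.1, hz2⟩

theorem RegularPoint.eventually_right {y : ℝ} {s w : ℂ} (h : RegularPoint y s w) :
    ∀ᶠ z in nhds w, RegularPoint y s z :=
  h.swap.eventually_left.mono fun _ hz => hz.swap

theorem fy_eq_sum {y : ℝ} {s w : ℂ} (hs : 0 < s.re) (hw : 0 < w.re) :
    fy y s w = ∑ p ∈ primesLe y, ((eulerLogC p s + eulerLogC p w) / 2 -
      Complex.log (sinhRatioC (eulerLogC p s - eulerLogC p w))) :=
  Finset.sum_congr rfl fun _ hp => Xi_cpow_eq (two_le_of_mem_primesLe hp) hs hw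

theorem RegularPoint.hasDerivAt_left {y : ℝ} {s w : ℂ} (h : RegularPoint y s w) :
    HasDerivAt (fun z => fy y z w) (∑ p ∈ primesLe y, eulerLogC' p s *
      (1 / 2 - hOneC (eulerLogC p s - eulerLogC p w))) s := by
  have h1 : HasDerivAt (fun z => ∑ p ∈ primesLe y, ((eulerLogC p z + eulerLogC p w) / 2 -
      Complex.log (sinhRatioC (eulerLogC p z - eulerLogC p w))))
      (∑ p ∈ primesLe y, eulerLogC' p s *
        (1 / 2 - hOneC (eulerLogC p s - eulerLogC p w))) s := by
    refine HasDerivAt.fun_sum fun p hp => ?_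
    have hA := hasDerivAt_eulerLogC (two_le_of_mem_primesLe hp) h.1
    refine (((hA.add_const (eulerLogC p w)).div_const 2).sub
      ((hasDerivAt_log_sinhRatioC (h.2.2 p hp)).comp s (hA.sub_const _))).congr_deriv ?_
    ring
  refine h1.congr_of_eventuallyEq ?_
  filter_upwards [h.eventually_left] with z hz
  exact fy_eq_sum hz.1 hz.2.1

theorem RegularPoint.hasDerivAt_right {y : ℝ} {s w : ℂ} (h : RegularPoint y s w) :
    HasDerivAt (fy y s) (∑ p ∈ primesLe y, eulerLogC' p w *
      (1 / 2 + hOneC (eulerLogC p s - eulerLogC p w))) w := by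
  have h1 : HasDerivAt (fun z => ∑ p ∈ primesLe y, ((eulerLogC p s + eulerLogC p z) / 2 -
      Complex.log (sinhRatioC (eulerLogC p s - eulerLogC p z))))
      (∑ p ∈ primesLe y, eulerLogC' p w *
        (1 / 2 + hOneC (eulerLogC p s - eulerLogC p w))) w := by
    refine HasDerivAt.fun_sum fun p hp => ?_
    have hA := hasDerivAt_eulerLogC (two_le_of_mem_primesLe hp) h.2.1
    refine (((hA.const_add (eulerLogC p s)).div_const 2).sub
      ((hasDerivAt_log_sinhRatioC (h.2.2 p hp)).comp w (hA.const_sub _))).congr_deriv ?_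
    ring
  refine h1.congr_of_eventuallyEq ?_
  filter_upwards [h.eventually_right] with z hz
  exact fy_eq_sum hz.1 hz.2.1

theorem RegularPoint.pdv_one_zero {y : ℝ} {s w : ℂ} (h : RegularPoint y s w) :
    pdv 1 0 (fy y) s w = ∑ p ∈ primesLe y, eulerLogC' p s *
      (1 / 2 - hOneC (eulerLogC p s - eulerLogC p w)) := by
  simp only [pdv, iteratedDeriv_zero, iteratedDeriv_one]
  exact h.hasDerivAt_left.deriv

theorem RegularPoint.pdv_zero_one {y : ℝ} {s w : ℂ} (h : RegularPoint y s w) :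
    pdv 0 1 (fy y) s w = ∑ p ∈ primesLe y, eulerLogC' p w *
      (1 / 2 + hOneC (eulerLogC p s - eulerLogC p w)) := by
  simp only [pdv, iteratedDeriv_zero, iteratedDeriv_one]
  exact h.hasDerivAt_right.deriv

theorem RegularPoint.pdv_two_zero {y : ℝ} {s w : ℂ} (h : RegularPoint y s w) :
    pdv 2 0 (fy y) s w = ∑ p ∈ primesLe y,
      (eulerLogC'' p s * (1 / 2 - hOneC (eulerLogC p s - eulerLogC p w)) -
        eulerLogC' p s ^ 2 * hTwoC (eulerLogC p s - eulerLogC p w)) := by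
  simp only [pdv, iteratedDeriv_zero]
  rw [iteratedDeriv_succ, iteratedDeriv_one]
  refine HasDerivAt.deriv (HasDerivAt.congr_of_eventuallyEq (f := fun s => ∑ p ∈ primesLe y,
    eulerLogC' p s * (1 / 2 - hOneC (eulerLogC p s - eulerLogC p w))) ?_ ?_)
  · refine HasDerivAt.fun_sum fun p hp => ?_
    have h2 := two_le_of_mem_primesLe hp
    refine ((hasDerivAt_eulerLogC' h2 h.1).mul (((hasDerivAt_hOneC (h.2.2 p hp)).comp s
      ((hasDerivAt_eulerLogC h2 h.1).sub_const _)).const_sub _)).congr_deriv ?_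
    simp only [Function.comp_def]
    ring
  · filter_upwards [h.eventually_left] with z hz
    exact hz.hasDerivAt_left.deriv

theorem RegularPoint.pdv_zero_two {y : ℝ} {s w : ℂ} (h : RegularPoint y s w) :
    pdv 0 2 (fy y) s w = ∑ p ∈ primesLe y,
      (eulerLogC'' p w * (1 / 2 + hOneC (eulerLogC p s - eulerLogC p w)) -
        eulerLogC' p w ^ 2 * hTwoC (eulerLogC p s - eulerLogC p w)) := by
  simp only [pdv, iteratedDeriv_zero]
  rw [iteratedDeriv_succ, iteratedDeriv_one]
  refine HasDerivAt.deriv (HasDerivAt.congr_of_eventuallyEq (f := fun w => ∑ p ∈ primesLe y,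
    eulerLogC' p w * (1 / 2 + hOneC (eulerLogC p s - eulerLogC p w))) ?_ ?_)
  · refine HasDerivAt.fun_sum fun p hp => ?_
    have h2 := two_le_of_mem_primesLe hp
    refine ((hasDerivAt_eulerLogC' h2 h.2.1).mul (((hasDerivAt_hOneC (h.2.2 p hp)).comp w
      ((hasDerivAt_eulerLogC h2 h.2.1).const_sub _)).const_add _)).congr_deriv ?_
    simp only [Function.comp_def]
    ring
  · filter_upwards [h.eventually_right] with z hz
    exact hz.hasDerivAt_right.deriv

theorem RegularPoint.pdv_one_one {y : ℝ} {s w : ℂ} (h : RegularPoint y s w) :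
    pdv 1 1 (fy y) s w = ∑ p ∈ primesLe y,
      eulerLogC' p s * eulerLogC' p w * hTwoC (eulerLogC p s - eulerLogC p w) := by
  simp only [pdv, iteratedDeriv_one]
  refine HasDerivAt.deriv (HasDerivAt.congr_of_eventuallyEq (f := fun s => ∑ p ∈ primesLe y,
    eulerLogC' p w * (1 / 2 + hOneC (eulerLogC p s - eulerLogC p w))) ?_ ?_)
  · refine HasDerivAt.fun_sum fun p hp => ?_
    have h2 := two_le_of_mem_primesLe hp
    refine (((((hasDerivAt_hOneC (h.2.2 p hp)).comp s
      ((hasDerivAt_eulerLogC h2 h.1).sub_const _)).const_add _)).const_mul _).congr_deriv ?_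
    ring
  · filter_upwards [h.eventually_left] with z hz
    exact hz.hasDerivAt_right.deriv

/-- The real logarithm `-log(1 - p^{-σ})` of an Euler factor. -/
def eulerLog (p : ℕ) (σ : ℝ) : ℝ := -Real.log (1 - (p : ℝ) ^ (-σ))

/-- The derivative of `eulerLog p`. -/
def eulerLog' (p : ℕ) (σ : ℝ) : ℝ := -(Real.log p / ((p : ℝ) ^ σ - 1))

/-- The second derivative of `eulerLog p`. -/
def eulerLog'' (p : ℕ) (σ : ℝ) : ℝ :=
  Real.log p ^ 2 * (p : ℝ) ^ σ / ((p : ℝ) ^ σ - 1) ^ 2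

theorem rpow_neg_lt_one {p : ℕ} (hp : 2 ≤ p) {σ : ℝ} (hσ : 0 < σ) : (p : ℝ) ^ (-σ) < 1 :=
  Real.rpow_lt_one_of_one_lt_of_neg (by exact_mod_cast hp) (by linarith)

theorem ofReal_eulerLog {p : ℕ} (hp : 2 ≤ p) {σ : ℝ} (hσ : 0 < σ) :
    ((eulerLog p σ : ℝ) : ℂ) = eulerLogC p σ := by
  have h := rpow_neg_lt_one hp hσ
  rw [eulerLog, eulerLogC, Complex.ofReal_neg, Complex.ofReal_log (by linarith)]
  push_cast [Complex.ofReal_cpow (Nat.cast_nonneg p)]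
  rfl

theorem ofReal_eulerLog' (p : ℕ) (σ : ℝ) : ((eulerLog' p σ : ℝ) : ℂ) = eulerLogC' p σ := by
  rw [eulerLog', eulerLogC']
  push_cast [Complex.ofReal_cpow (Nat.cast_nonneg p), Complex.natCast_log]
  rfl

theorem ofReal_eulerLog'' (p : ℕ) (σ : ℝ) : ((eulerLog'' p σ : ℝ) : ℂ) = eulerLogC'' p σ := by
  rw [eulerLog'', eulerLogC'']
  push_cast [Complex.ofReal_cpow (Nat.cast_nonneg p), Complex.natCast_log]
  rfl

theorem ofReal_hOne (x : ℝ) : ((hOne x : ℝ) : ℂ) = hOneC x := by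
  rw [hOne, hOneC, Complex.ofReal_div, ofReal_sinhRatio, ofReal_deriv_sinhRatio]

theorem ofReal_hTwo (x : ℝ) : ((hTwo x : ℝ) : ℂ) = hTwoC x := by
  rw [hTwo, hTwoC, ← ofReal_hOne, ← ofReal_sinhRatio, ← ofReal_deriv_deriv_sinhRatio]
  push_cast
  rfl

theorem regularPoint_ofReal (y : ℝ) {σ κ : ℝ} (hσ : 0 < σ) (hκ : 0 < κ) :
    RegularPoint y σ κ := by
  refine ⟨by simpa using hσ, by simpa using hκ, fun p hp => ?_⟩
  have h2 := two_le_of_mem_primesLe hp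
  rw [← ofReal_eulerLog h2 hσ, ← ofReal_eulerLog h2 hκ, ← Complex.ofReal_sub, ← ofReal_sinhRatio]
  exact Complex.ofReal_mem_slitPlane.2 (sinhRatio_pos _)

theorem fy_ofReal (y : ℝ) {σ κ : ℝ} (hσ : 0 < σ) (hκ : 0 < κ) :
    fy y σ κ = ((∑ p ∈ primesLe y, ((eulerLog p σ + eulerLog p κ) / 2 -
      Real.log (sinhRatio (eulerLog p σ - eulerLog p κ))) : ℝ) : ℂ) := by
  rw [fy_eq_sum (by simpa using hσ) (by simpa using hκ), Complex.ofReal_sum]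
  refine Finset.sum_congr rfl fun p hp => ?_
  have h2 := two_le_of_mem_primesLe hp
  rw [← ofReal_eulerLog h2 hσ, ← ofReal_eulerLog h2 hκ, ← Complex.ofReal_sub, ← ofReal_sinhRatio,
    ← Complex.ofReal_log (sinhRatio_pos _).le]
  push_cast
  rfl

theorem pdv_one_zero_ofReal (y : ℝ) {σ κ : ℝ} (hσ : 0 < σ) (hκ : 0 < κ) :
    pdv 1 0 (fy y) σ κ = ((∑ p ∈ primesLe y, eulerLog' p σ *
      (1 / 2 - hOne (eulerLog p σ - eulerLog p κ)) : ℝ) : ℂ) := by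
  rw [(regularPoint_ofReal y hσ hκ).pdv_one_zero, Complex.ofReal_sum]
  refine Finset.sum_congr rfl fun p hp => ?_
  have h2 := two_le_of_mem_primesLe hp
  rw [← ofReal_eulerLog h2 hσ, ← ofReal_eulerLog h2 hκ, ← Complex.ofReal_sub, ← ofReal_hOne,
    ← ofReal_eulerLog']
  push_cast
  rfl

theorem pdv_zero_one_ofReal (y : ℝ) {σ κ : ℝ} (hσ : 0 < σ) (hκ : 0 < κ) :
    pdv 0 1 (fy y) σ κ = ((∑ p ∈ primesLe y, eulerLog' p κ *
      (1 / 2 + hOne (eulerLog p σ - eulerLog p κ)) : ℝ) : ℂ) := by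
  rw [(regularPoint_ofReal y hσ hκ).pdv_zero_one, Complex.ofReal_sum]
  refine Finset.sum_congr rfl fun p hp => ?_
  have h2 := two_le_of_mem_primesLe hp
  rw [← ofReal_eulerLog h2 hσ, ← ofReal_eulerLog h2 hκ, ← Complex.ofReal_sub, ← ofReal_hOne,
    ← ofReal_eulerLog']
  push_cast
  rfl

theorem HessC_ofReal (y : ℝ) {σ κ : ℝ} (hσ : 0 < σ) (hκ : 0 < κ) :
    HessC y σ κ = (((∑ p ∈ primesLe y,
      (eulerLog'' p σ * (1 / 2 - hOne (eulerLog p σ - eulerLog p κ)) -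
        eulerLog' p σ ^ 2 * hTwo (eulerLog p σ - eulerLog p κ))) *
      (∑ p ∈ primesLe y,
      (eulerLog'' p κ * (1 / 2 - hOne (eulerLog p κ - eulerLog p σ)) -
        eulerLog' p κ ^ 2 * hTwo (eulerLog p κ - eulerLog p σ))) -
      (∑ p ∈ primesLe y,
        eulerLog' p σ * eulerLog' p κ * hTwo (eulerLog p σ - eulerLog p κ)) ^ 2 : ℝ) : ℂ) := by
  have h := regularPoint_ofReal y hσ hκ
  rw [HessC, h.pdv_two_zero, h.pdv_zero_two, h.pdv_one_one, Complex.ofReal_sub, Complex.ofReal_mul,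
    Complex.ofReal_pow, Complex.ofReal_sum, Complex.ofReal_sum, Complex.ofReal_sum]
  refine congrArg₂ (· - ·) (congrArg₂ (· * ·) ?_ ?_) (congrArg (· ^ 2) ?_)
  · refine Finset.sum_congr rfl fun p hp => ?_
    have h2 := two_le_of_mem_primesLe hp
    rw [← ofReal_eulerLog h2 hσ, ← ofReal_eulerLog h2 hκ, ← Complex.ofReal_sub, ← ofReal_hOne,
      ← ofReal_hTwo, ← ofReal_eulerLog', ← ofReal_eulerLog'']
    push_cast
    rfl
  · refine Finset.sum_congr rfl fun p hp => ?_
    have h2 := two_le_of_mem_primesLe hp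
    rw [← ofReal_eulerLog h2 hσ, ← ofReal_eulerLog h2 hκ, ← Complex.ofReal_sub, ← ofReal_hOne,
      ← ofReal_hTwo, ← ofReal_eulerLog', ← ofReal_eulerLog'',
      ← neg_sub (eulerLog p σ) (eulerLog p κ), hOne_neg, hTwo_neg]
    push_cast
    ring
  · refine Finset.sum_congr rfl fun p hp => ?_
    have h2 := two_le_of_mem_primesLe hp
    rw [← ofReal_eulerLog h2 hσ, ← ofReal_eulerLog h2 hκ, ← Complex.ofReal_sub,
    ← ofReal_hTwo, ← ofReal_eulerLog', ← ofReal_eulerLog']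
    push_cast
    rfl

theorem log_natCast_pos {p : ℕ} (hp : 2 ≤ p) : 0 < Real.log p :=
  Real.log_pos (by exact_mod_cast hp)

theorem natCast_rpow_eq_exp {p : ℕ} (hp : 2 ≤ p) (σ : ℝ) :
    (p : ℝ) ^ σ = Real.exp (σ * Real.log p) := by
  rw [Real.rpow_def_of_pos (by positivity), mul_comm]

theorem natCast_rpow_sub_one_pos {p : ℕ} (hp : 2 ≤ p) {σ : ℝ} (hσ : 0 < σ) :
    0 < (p : ℝ) ^ σ - 1 :=
  sub_pos.2 (Real.one_lt_rpow (by exact_mod_cast hp) hσ)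

theorem mul_log_le_natCast_rpow_sub_one {p : ℕ} (hp : 2 ≤ p) (σ : ℝ) :
    σ * Real.log p ≤ (p : ℝ) ^ σ - 1 := by
  rw [natCast_rpow_eq_exp hp]
  linarith [Real.add_one_le_exp (σ * Real.log p)]

theorem log_div_natCast_rpow_sub_one_le {p : ℕ} (hp : 2 ≤ p) {σ : ℝ} (hσ : 0 < σ) :
    Real.log p / ((p : ℝ) ^ σ - 1) ≤ 1 / σ := by
  rw [div_le_div_iff₀ (natCast_rpow_sub_one_pos hp hσ) hσ]
  linarith [mul_log_le_natCast_rpow_sub_one hp σ]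

theorem le_log_div_natCast_rpow_sub_one {p : ℕ} (hp : 2 ≤ p) {σ : ℝ} (hσ : 0 < σ)
    (h : σ * Real.log p ≤ 1) : 1 / (2 * σ) ≤ Real.log p / ((p : ℝ) ^ σ - 1) := by
  have hl := log_natCast_pos hp
  have h0 : 0 ≤ σ * Real.log p := by positivity
  rw [div_le_div_iff₀ (by positivity) (natCast_rpow_sub_one_pos hp hσ), natCast_rpow_eq_exp hp]
  have h1 := Real.abs_exp_sub_one_sub_id_le (x := σ * Real.log p) (by rwa [abs_of_nonneg h0])
  have h2 := (abs_le.1 h1).2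
  nlinarith

theorem eulerLog_eq {p : ℕ} (hp : 2 ≤ p) {σ : ℝ} (hσ : 0 < σ) :
    eulerLog p σ = σ * Real.log p - Real.log ((p : ℝ) ^ σ - 1) := by
  have hp0 : (0 : ℝ) < p := by positivity
  have h1 := natCast_rpow_sub_one_pos hp hσ
  have h2 : (0 : ℝ) < (p : ℝ) ^ σ := by positivity
  have h3 : 1 - (p : ℝ) ^ (-σ) = ((p : ℝ) ^ σ - 1) / (p : ℝ) ^ σ := by
    rw [Real.rpow_neg hp0.le]
    field_simp
  rw [eulerLog, h3, Real.log_div h1.ne' h2.ne', Real.log_rpow hp0]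
  ring

/-- The length scale `log y + 1/α` of the saddle-point problem. -/
def saddleScale (y α : ℝ) : ℝ := Real.log y + 1 / α

/-- The rescaled logarithm of `p`. -/
def scaledLog (y α : ℝ) (p : ℕ) : ℝ := Real.log p / saddleScale y α

/-- The rescaled weight `log p / (p^α - 1)`. -/
def scaledWeight (y α : ℝ) (p : ℕ) : ℝ := Real.log p / ((p : ℝ) ^ α - 1) / saddleScale y α

section Scaled

variable {y α : ℝ} {p : ℕ}

theorem saddleScale_pos (hy : 2 ≤ y) (hα : 0 < α) : 0 < saddleScale y α :=
  add_pos (Real.log_pos (by linarith)) (by positivity)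

theorem scaledLog_pos (hy : 2 ≤ y) (hα : 0 < α) (hp : 2 ≤ p) : 0 < scaledLog y α p :=
  div_pos (log_natCast_pos hp) (saddleScale_pos hy hα)

theorem scaledWeight_pos (hy : 2 ≤ y) (hα : 0 < α) (hp : 2 ≤ p) : 0 < scaledWeight y α p :=
  div_pos (div_pos (log_natCast_pos hp) (natCast_rpow_sub_one_pos hp hα)) (saddleScale_pos hy hα)

theorem log_le_of_mem_primesLe (hy : 2 ≤ y) (hp : p ∈ primesLe y) : Real.log p ≤ Real.log y :=
  Real.log_le_log (by have := two_le_of_mem_primesLe hp; positivity)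
    ((mem_primesLe (by linarith)).1 hp).2

theorem scaledLog_add_scaledWeight_le (hy : 2 ≤ y) (hα : 0 < α) (hp : p ∈ primesLe y) :
    scaledLog y α p + scaledWeight y α p ≤ 1 := by
  rw [scaledLog, scaledWeight, ← add_div, div_le_one (saddleScale_pos hy hα), saddleScale]
  exact add_le_add (log_le_of_mem_primesLe hy hp)
    (log_div_natCast_rpow_sub_one_le (two_le_of_mem_primesLe hp) hα)

theorem scaledLog_mul (hy : 2 ≤ y) (hα : 0 < α) (t : ℝ) :
    scaledLog y α p * (saddleScale y α * t) = t * Real.log p := by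
  have := (saddleScale_pos hy hα).ne'
  rw [scaledLog]
  field_simp

theorem scaled_r_eq (hy : 2 ≤ y) (hα : 0 < α) (hp : 2 ≤ p) (τ : ℝ) :
    1 + (scaledLog y α p + scaledWeight y α p) *
      ((Real.exp (scaledLog y α p * (saddleScale y α * (τ - α))) - 1) / scaledLog y α p) =
      ((p : ℝ) ^ τ - 1) / ((p : ℝ) ^ α - 1) := by
  have hT := (saddleScale_pos hy hα).ne'
  have hl := (log_natCast_pos hp).ne'
  have h1 := (natCast_rpow_sub_one_pos hp hα).ne'
  have h2 : (p : ℝ) ^ α ≠ 0 := by positivity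
  rw [scaledLog_mul hy hα, sub_mul, Real.exp_sub, ← natCast_rpow_eq_exp hp,
    ← natCast_rpow_eq_exp hp, scaledLog, scaledWeight]
  field_simp
  ring

theorem eulerLog_eq_add (hα : 0 < α) (hp : 2 ≤ p) {τ : ℝ} (hτ : 0 < τ) :
    eulerLog p τ = eulerLog p α +
      ((τ - α) * Real.log p - Real.log (((p : ℝ) ^ τ - 1) / ((p : ℝ) ^ α - 1))) := by
  rw [eulerLog_eq hp hτ, eulerLog_eq hp hα, Real.log_div (natCast_rpow_sub_one_pos hp hτ).ne'
    (natCast_rpow_sub_one_pos hp hα).ne']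
  ring

theorem eulerLog'_eq_scaled (hy : 2 ≤ y) (hα : 0 < α) (hp : 2 ≤ p) {τ : ℝ} (hτ : 0 < τ) :
    eulerLog' p τ = saddleScale y α * (scaledWeight y α p *
      -(((p : ℝ) ^ τ - 1) / ((p : ℝ) ^ α - 1))⁻¹) := by
  have hT := (saddleScale_pos hy hα).ne'
  have h1 := (natCast_rpow_sub_one_pos hp hα).ne'
  have h2 := (natCast_rpow_sub_one_pos hp hτ).ne'
  rw [eulerLog', scaledWeight]
  field_simp

theorem eulerLog''_eq_scaled (hy : 2 ≤ y) (hα : 0 < α) (hp : 2 ≤ p) {τ : ℝ} (hτ : 0 < τ) :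
    eulerLog'' p τ = saddleScale y α ^ 2 * (scaledWeight y α p *
      ((((p : ℝ) ^ τ - 1) / ((p : ℝ) ^ α - 1))⁻¹ * (((p : ℝ) ^ τ - 1) / ((p : ℝ) ^ α - 1))⁻¹ *
        ((scaledLog y α p + scaledWeight y α p) *
          Real.exp (scaledLog y α p * (saddleScale y α * (τ - α)))))) := by
  have hT := (saddleScale_pos hy hα).ne'
  have hl := (log_natCast_pos hp).ne'
  have h1 := (natCast_rpow_sub_one_pos hp hα).ne'
  have h2 := (natCast_rpow_sub_one_pos hp hτ).ne'
  have h3 : (p : ℝ) ^ α ≠ 0 := by positivity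
  rw [scaledLog_mul hy hα, sub_mul, Real.exp_sub, ← natCast_rpow_eq_exp hp,
    ← natCast_rpow_eq_exp hp, scaledLog, scaledWeight, eulerLog'']
  field_simp
  ring

theorem scaledWeight_mul_eq (hy : 2 ≤ y) (hα : 0 < α) (hp : 2 ≤ p) :
    scaledWeight y α p * ((scaledLog y α p + scaledWeight y α p) / 2 - scaledWeight y α p / 6) =
      (Real.log p ^ 2 * (p : ℝ) ^ α / ((p : ℝ) ^ α - 1) ^ 2 -
        Real.log p ^ 2 / ((p : ℝ) ^ α - 1) ^ 2 / 3) / (2 * saddleScale y α ^ 2) := by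
  have hT := (saddleScale_pos hy hα).ne'
  have h1 := (natCast_rpow_sub_one_pos hp hα).ne'
  rw [scaledLog, scaledWeight]
  field_simp
  ring

theorem rhoXY_sq (hα : 0 < α) :
    rhoXY y α ^ 2 = (sigma2 y α - sigma2t y α / 3) / 4 := by
  have h : 0 ≤ sigma2 y α - sigma2t y α / 3 := by
    rw [sub_nonneg, sigma2, sigma2t, Finset.sum_div]
    refine Finset.sum_le_sum fun p hp => ?_
    have h1 := natCast_rpow_sub_one_pos (two_le_of_mem_primesLe hp) hα
    rw [div_right_comm]
    refine div_le_div_of_nonneg_right ?_ (by positivity)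
    nlinarith [sq_nonneg (Real.log p)]
  rw [rhoXY, mul_pow, Real.sq_sqrt h]
  ring

end Scaled

section Ubar

variable {x y α : ℝ}

theorem one_le_ubar (hy : 2 ≤ y) (hxy : y ≤ x) : 1 ≤ ubar x y := by
  refine le_min ?_ ?_
  · rw [one_le_div (Real.log_pos (by linarith))]
    exact Real.log_le_log (by linarith) hxy
  · have : 2 ∈ primesLe y := (mem_primesLe (by linarith)).2 ⟨Nat.prime_two, by simpa using hy⟩
    exact_mod_cast Finset.card_pos.2 ⟨2, this⟩

theorem ubar_mul_log_le (hy : 2 ≤ y) : ubar x y * Real.log y ≤ Real.log x := by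
  rw [← le_div_iff₀ (Real.log_pos (by linarith))]
  exact min_le_left _ _

theorem sum_scaledWeight (h : saddleEq x y α) :
    ∑ p ∈ primesLe y, scaledWeight y α p = Real.log x / saddleScale y α := by
  simp only [scaledWeight]
  rw [← Finset.sum_div, h]

theorem log_le_ubar_mul_saddleScale (hy : 2 ≤ y) (hxy : y ≤ x) (hα : 0 < α)
    (h : saddleEq x y α) : Real.log x ≤ ubar x y * saddleScale y α := by
  have hL : 0 < Real.log y := Real.log_pos (by linarith)
  have hα' : 0 < 1 / α := by positivity
  rw [ubar]
  rcases min_choice (Real.log x / Real.log y) ((primesLe y).card : ℝ) with h1 | h1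
  · rw [h1, saddleScale, mul_add, div_mul_cancel₀ _ hL.ne']
    have : 0 ≤ Real.log x := Real.log_nonneg (by linarith)
    have : 0 ≤ Real.log x / Real.log y * (1 / α) := by positivity
    linarith
  · rw [h1, ← h]
    refine (Finset.sum_le_card_nsmul _ _ (1 / α) fun p hp =>
      log_div_natCast_rpow_sub_one_le (two_le_of_mem_primesLe hp) hα).trans ?_
    rw [nsmul_eq_mul, saddleScale]
    exact mul_le_mul_of_nonneg_left (by linarith) (Nat.cast_nonneg _)

theorem le_sum_scaledWeight_mul (hy : 2 ≤ y) (hxy : y ≤ x) (hα : 0 < α) (hα1 : α ≤ 1)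
    (h : saddleEq x y α) :
    1 / 384 ≤ ∑ p ∈ primesLe y, (ubar x y)⁻¹ * scaledWeight y α p *
      (scaledLog y α p + scaledWeight y α p) := by
  have hL : 0 < Real.log y := Real.log_pos (by linarith)
  have hU : 0 < ubar x y := zero_lt_one.trans_le (one_le_ubar hy hxy)
  have hT := saddleScale_pos hy hα
  simp only [mul_assoc]
  rw [← Finset.mul_sum, ← div_eq_inv_mul, le_div_iff₀ hU]
  rcases le_total 1 (α * Real.log y) with h1 | h1
  · have hT2 : saddleScale y α ≤ 2 * Real.log y := by
      have : 1 / α ≤ Real.log y := by rw [div_le_iff₀ hα]; linarith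
      rw [saddleScale]
      linarith
    have h2 := log_mul_sum_log_div_rpow_pred_le hy hα hα1
    have h3 := ubar_mul_log_le (x := x) hy
    rw [h] at h2
    have h4 : (∑ p ∈ primesLe y, Real.log p * (Real.log p / ((p : ℝ) ^ α - 1))) /
        saddleScale y α ^ 2 ≤ ∑ p ∈ primesLe y, scaledWeight y α p *
          (scaledLog y α p + scaledWeight y α p) := by
      rw [Finset.sum_div]
      refine Finset.sum_le_sum fun p hp => ?_
      have hw := scaledWeight_pos hy hα (two_le_of_mem_primesLe hp)
      have : Real.log p * (Real.log p / ((p : ℝ) ^ α - 1)) / saddleScale y α ^ 2 =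
          scaledWeight y α p * scaledLog y α p := by
        rw [scaledWeight, scaledLog]
        field_simp
      rw [this]
      exact mul_le_mul_of_nonneg_left (by linarith) hw.le
    refine le_trans ?_ h4
    rw [le_div_iff₀ (by positivity)]
    have h5 : saddleScale y α ^ 2 ≤ (2 * Real.log y) ^ 2 := pow_le_pow_left₀ hT.le hT2 2
    calc 1 / 384 * ubar x y * saddleScale y α ^ 2
        ≤ 1 / 384 * ubar x y * (2 * Real.log y) ^ 2 :=
          mul_le_mul_of_nonneg_left h5 (by positivity)
      _ = 1 / 96 * Real.log y * (ubar x y * Real.log y) := by ring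
      _ ≤ 1 / 96 * Real.log y * Real.log x := mul_le_mul_of_nonneg_left h3 (by positivity)
      _ ≤ _ := h2
  · have hT2 : saddleScale y α ≤ 2 / α := by
      have : Real.log y ≤ 1 / α := by rw [le_div_iff₀ hα]; linarith
      rw [saddleScale]
      have : 2 / α = 1 / α + 1 / α := by ring
      linarith
    have h2 : ∀ p ∈ primesLe y, 1 / 16 ≤ scaledWeight y α p *
        (scaledLog y α p + scaledWeight y α p) := by
      intro p hp
      have hp2 := two_le_of_mem_primesLe hp
      have hlp := log_le_of_mem_primesLe hy hp
      have h3 := le_log_div_natCast_rpow_sub_one hp2 hα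
        ((mul_le_mul_of_nonneg_left hlp hα.le).trans h1)
      have h4 : 1 / 4 ≤ scaledWeight y α p := by
        rw [scaledWeight, le_div_iff₀ hT]
        have : 1 / 4 * (2 / α) = 1 / (2 * α) := by field_simp; norm_num
        linarith
      have h5 := scaledLog_pos hy hα hp2
      nlinarith
    have h3 := Finset.card_nsmul_le_sum _ _ _ h2
    rw [nsmul_eq_mul] at h3
    have h4 : ubar x y ≤ (primesLe y).card := min_le_right _ _
    linarith

end Ubar

theorem half_mul_le_one_sub_two_rpow_neg {σ : ℝ} (h0 : 0 ≤ σ) (h1 : σ ≤ 1) :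
    σ / 2 ≤ 1 - (2 : ℝ) ^ (-σ) := by
  have h := rpow_one_add_le_one_add_mul_self (s := -1 / 2) (p := σ) (by norm_num) h0 h1
  have : (2 : ℝ) ^ (-σ) = (1 + -1 / 2) ^ σ := by
    rw [Real.rpow_neg (by norm_num), ← Real.inv_rpow (by norm_num)]
    norm_num
  rw [this]
  linarith

theorem one_sub_two_rpow_neg_le {σ : ℝ} (h0 : 0 ≤ σ) : 1 - (2 : ℝ) ^ (-σ) ≤ σ := by
  rw [Real.rpow_def_of_pos (by norm_num)]
  have h1 := Real.add_one_le_exp (Real.log 2 * -σ)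
  have h2 : Real.log 2 ≤ 1 := by linarith [Real.log_two_lt_d9]
  nlinarith

/-- Points at which all rescaled quantities are bounded in terms of `δ`. -/
def NearSaddle (δ α y τ : ℝ) : Prop :=
  |τ - α| * Real.log y ≤ δ ∧ |τ - α| ≤ 2 * (1 + δ) * α ∧ α ≤ 2 * (1 + δ) * τ

theorem nearSaddle_of_mem_Ddom {δ α y σ κ : ℝ} (hδ : 0 < δ) (hy : 2 ≤ y)
    (h : (σ, κ) ∈ Ddom δ α y) : NearSaddle δ α y σ ∧ NearSaddle δ α y κ := by
  obtain ⟨s0, s1, k0, k1, hbet, hlow, hup, hd⟩ := h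
  simp only at s0 s1 k0 k1 hbet hlow hup hd
  have hL : 0 < Real.log y := Real.log_pos (by linarith)
  have a1 := half_mul_le_one_sub_two_rpow_neg s0.le s1
  have a2 := half_mul_le_one_sub_two_rpow_neg k0.le k1
  have a3 := one_sub_two_rpow_neg_le s0.le
  have a4 := one_sub_two_rpow_neg_le k0.le
  generalize 1 - (2 : ℝ) ^ (-σ) = S at *
  generalize 1 - (2 : ℝ) ^ (-κ) = K at *
  have hK : 0 < K := by linarith
  rw [div_le_div_iff₀ (by linarith) hK] at hlow
  rw [div_le_iff₀ hK] at hup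
  have b1 : σ ≤ 2 * (1 + δ) * κ := by nlinarith
  have b2 : κ ≤ 2 * (1 + δ) * σ := by nlinarith
  have hsk : (σ ≥ α ∧ α ≥ κ) ∨ (σ ≤ α ∧ α ≤ κ) := by
    rcases mul_nonneg_iff.1 hbet with h | h
    · left; constructor <;> linarith [h.1, h.2]
    · right; constructor <;> linarith [h.1, h.2]
  have hle : |σ - α| ≤ |σ - κ| ∧ |κ - α| ≤ |σ - κ| := by
    rcases hsk with h | h
    · rw [abs_of_nonneg (by linarith : 0 ≤ σ - κ)]
      constructor <;> rw [abs_le] <;> constructor <;> linarith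
    · rw [abs_of_nonpos (by linarith : σ - κ ≤ 0)]
      constructor <;> rw [abs_le] <;> constructor <;> linarith
  have c1 : |σ - κ| ≤ 2 * (1 + δ) * α := by
    rcases hsk with h | h
    · rw [abs_of_nonneg (by linarith : 0 ≤ σ - κ)]; nlinarith
    · rw [abs_of_nonpos (by linarith : σ - κ ≤ 0)]; nlinarith
  refine ⟨⟨(mul_le_mul_of_nonneg_right hle.1 hL.le).trans hd, hle.1.trans c1, ?_⟩,
    ⟨(mul_le_mul_of_nonneg_right hle.2 hL.le).trans hd, hle.2.trans c1, ?_⟩⟩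
  · rcases hsk with h | h <;> nlinarith
  · rcases hsk with h | h <;> nlinarith

theorem NearSaddle.abs_mul_saddleScale_le {δ α y τ : ℝ} (hy : 2 ≤ y) (hα : 0 < α)
    (h : NearSaddle δ α y τ) : |saddleScale y α * (τ - α)| ≤ δ + 2 * (1 + δ) := by
  have h3 : |τ - α| * (1 / α) ≤ 2 * (1 + δ) := by
    rw [mul_one_div, div_le_iff₀ hα]
    exact h.2.1
  rw [abs_mul, abs_of_pos (saddleScale_pos hy hα), saddleScale]
  linarith [h.1]

theorem NearSaddle.le_div {δ α y τ : ℝ} {p : ℕ} (hδ : 0 < δ) (hy : 2 ≤ y) (hα : 0 < α)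
    (hτ : 0 < τ) (h : NearSaddle δ α y τ) (hp : p ∈ primesLe y) :
    1 / (Real.exp δ * (1 + 2 * (1 + δ))) ≤ ((p : ℝ) ^ τ - 1) / ((p : ℝ) ^ α - 1) := by
  have hp2 := two_le_of_mem_primesLe hp
  have hpα := natCast_rpow_sub_one_pos hp2 hα
  have hE : 1 ≤ Real.exp δ := Real.one_le_exp hδ.le
  have hpτ := natCast_rpow_sub_one_pos hp2 hτ
  rw [div_le_div_iff₀ (by positivity) hpα, one_mul]
  rcases le_total α τ with hατ | hατ
  · have h1 : (p : ℝ) ^ α ≤ (p : ℝ) ^ τ :=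
      Real.rpow_le_rpow_of_exponent_le (by exact_mod_cast (by omega : 1 ≤ p)) hατ
    have h2 : 1 ≤ Real.exp δ * (1 + 2 * (1 + δ)) := by nlinarith
    nlinarith
  · have hl := log_natCast_pos hp2
    have hlp := log_le_of_mem_primesLe hy hp
    obtain ⟨h1, -, h3⟩ := h
    rw [abs_of_nonpos (by linarith)] at h1
    set d := (α - τ) * Real.log p with hd
    have hd0 : 0 ≤ d := mul_nonneg (by linarith) hl.le
    have hdδ : d ≤ δ := by nlinarith
    have e1 : (p : ℝ) ^ α = (p : ℝ) ^ τ * Real.exp d := by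
      rw [natCast_rpow_eq_exp hp2, natCast_rpow_eq_exp hp2, ← Real.exp_add, hd]
      ring_nf
    have e2 : Real.exp d ≤ Real.exp δ := Real.exp_le_exp.2 hdδ
    have e3 : Real.exp d - 1 ≤ d * Real.exp d := by
      have := abs_exp_sub_one_le_mul_exp d
      rw [abs_of_nonneg hd0] at this
      exact (le_abs_self _).trans this
    have e4 := mul_log_le_natCast_rpow_sub_one hp2 τ
    have e5 : d ≤ 2 * (1 + δ) * ((p : ℝ) ^ τ - 1) := by
      have : d ≤ 2 * (1 + δ) * (τ * Real.log p) := by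
        rw [hd, ← mul_assoc]
        exact mul_le_mul_of_nonneg_right (by linarith) hl.le
      exact this.trans (mul_le_mul_of_nonneg_left e4 (by positivity))
    calc (p : ℝ) ^ α - 1 = ((p : ℝ) ^ τ - 1) * Real.exp d + (Real.exp d - 1) := by rw [e1]; ring
      _ ≤ ((p : ℝ) ^ τ - 1) * Real.exp d + 2 * (1 + δ) * ((p : ℝ) ^ τ - 1) * Real.exp d := by
        linarith [mul_le_mul_of_nonneg_right e5 (Real.exp_pos d).le]
      _ = ((p : ℝ) ^ τ - 1) * (1 + 2 * (1 + δ)) * Real.exp d := by ring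
      _ ≤ ((p : ℝ) ^ τ - 1) * (1 + 2 * (1 + δ)) * Real.exp δ :=
        mul_le_mul_of_nonneg_left e2 (by positivity)
      _ = _ := by ring

/-- A differentiable curve `β` through `α` that solves the saddle-point equations and stays
near `α`. -/
structure IsSaddlePath (c δ x y α : ℝ) (β : ℝ → ℝ) : Prop where
  c_pos : 0 < c
  delta_pos : 0 < δ
  two_le : 2 ≤ y
  le : y ≤ x
  alpha_pos : 0 < α
  saddleEq : saddleEq x y α
  differentiableOn : DifferentiableOn ℝ β
    (Set.Icc (-(c * Real.sqrt (ubar x y))) (c * Real.sqrt (ubar x y)))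
  zero : β 0 = α
  mem : ∀ v ∈ Set.Icc (-(c * Real.sqrt (ubar x y))) (c * Real.sqrt (ubar x y)),
    0 < β v ∧ β v ≤ 1
  near : ∀ v ∈ Set.Icc (-(c * Real.sqrt (ubar x y))) (c * Real.sqrt (ubar x y)),
    NearSaddle δ α y (β v)
  saddle : ∀ v ∈ Set.Icc (-(c * Real.sqrt (ubar x y))) (c * Real.sqrt (ubar x y)),
    ∑ p ∈ primesLe y, eulerLog' p (β v) *
      (1 / 2 - hOne (eulerLog p (β v) - eulerLog p (β (-v)))) =
      v * rhoXY y α - Real.log x / 2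

namespace IsSaddlePath

variable {c δ x y α : ℝ} {β : ℝ → ℝ}

theorem ubar_pos (h : IsSaddlePath c δ x y α β) : 0 < ubar x y :=
  zero_lt_one.trans_le (one_le_ubar h.two_le h.le)

theorem sqrt_pos (h : IsSaddlePath c δ x y α β) : 0 < Real.sqrt (ubar x y) :=
  Real.sqrt_pos.2 h.ubar_pos

theorem scale_pos (h : IsSaddlePath c δ x y α β) : 0 < saddleScale y α :=
  saddleScale_pos h.two_le h.alpha_pos

theorem mul_mem (h : IsSaddlePath c δ x y α β) {w : ℝ} (hw : w ∈ Set.Icc (-c) c) :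
    Real.sqrt (ubar x y) * w ∈
      Set.Icc (-(c * Real.sqrt (ubar x y))) (c * Real.sqrt (ubar x y)) := by
  have := h.sqrt_pos
  constructor <;> nlinarith [hw.1, hw.2]

theorem eulerLog_eq (h : IsSaddlePath c δ x y α β) {p : ℕ} (hp : p ∈ primesLe y) {τ : ℝ}
    (hτ : 0 < τ) : eulerLog p τ = eulerLog p α +
      (scaledLog y α p * (saddleScale y α * (τ - α)) - Real.log (1 +
        (scaledLog y α p + scaledWeight y α p) * ((Real.exp (scaledLog y α p *
          (saddleScale y α * (τ - α))) - 1) / scaledLog y α p))) := by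
  rw [scaled_r_eq h.two_le h.alpha_pos (two_le_of_mem_primesLe hp),
    scaledLog_mul h.two_le h.alpha_pos]
  exact eulerLog_eq_add h.alpha_pos (two_le_of_mem_primesLe hp) hτ

theorem sum_weight (h : IsSaddlePath c δ x y α β) :
    ∑ p ∈ primesLe y, (ubar x y)⁻¹ * scaledWeight y α p =
      Real.log x / (ubar x y * saddleScale y α) := by
  have := h.ubar_pos.ne'
  have := h.scale_pos.ne'
  rw [← Finset.mul_sum, sum_scaledWeight h.saddleEq]
  field_simp

theorem alpha_le_one (h : IsSaddlePath c δ x y α β) : α ≤ 1 := by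
  have h1 := (h.mem 0 ⟨by nlinarith [h.c_pos, h.sqrt_pos], by nlinarith [h.c_pos, h.sqrt_pos]⟩).2
  rwa [h.zero] at h1

theorem saddle_scaled (h : IsSaddlePath c δ x y α β) {w : ℝ} (hw : w ∈ Set.Icc (-c) c) :
    ∑ p ∈ primesLe y, (ubar x y)⁻¹ * scaledWeight y α p *
      (-(1 + (scaledLog y α p + scaledWeight y α p) * ((Real.exp (scaledLog y α p *
          (saddleScale y α * (β (Real.sqrt (ubar x y) * w) - α))) - 1) / scaledLog y α p))⁻¹ *
        (1 / 2 - hOne (eulerLog p (β (Real.sqrt (ubar x y) * w)) -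
          eulerLog p (β (Real.sqrt (ubar x y) * -w))))) =
      rhoXY y α / (Real.sqrt (ubar x y) * saddleScale y α) * w -
        Real.log x / (ubar x y * saddleScale y α) / 2 := by
  have hT := h.scale_pos
  have hq := h.sqrt_pos
  have hm := h.mul_mem hw
  have h1 := h.saddle _ hm
  rw [← mul_neg] at h1
  have h2 : rhoXY y α / (Real.sqrt (ubar x y) * saddleScale y α) * w -
        Real.log x / (ubar x y * saddleScale y α) / 2 = (ubar x y)⁻¹ * (saddleScale y α)⁻¹ *
        (Real.sqrt (ubar x y) * w * rhoXY y α - Real.log x / 2) := by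
    have hU : ubar x y = Real.sqrt (ubar x y) ^ 2 := (Real.sq_sqrt h.ubar_pos.le).symm
    generalize Real.sqrt (ubar x y) = q at *
    rw [hU]
    field_simp
  rw [h2, ← h1, Finset.mul_sum]
  refine Finset.sum_congr rfl fun p hp => ?_
  have hp2 := two_le_of_mem_primesLe hp
  rw [scaled_r_eq h.two_le h.alpha_pos hp2, eulerLog'_eq_scaled h.two_le h.alpha_pos hp2
    (h.mem _ hm).1]
  field_simp

/-- The rescaled saddle-point curve. -/
def curve (h : IsSaddlePath c δ x y α β) : SaddleCurve c (δ + 2 * (1 + δ))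
    (1 / (Real.exp δ * (1 + 2 * (1 + δ)))) (1 / 384) where
  K := primesLe y
  lam p := scaledLog y α p
  gam p := scaledLog y α p + scaledWeight y α p
  kap := (ubar x y)⁻¹
  rho := rhoXY y α / (Real.sqrt (ubar x y) * saddleScale y α)
  B w := saddleScale y α * (β (Real.sqrt (ubar x y) * w) - α)
  lam_pos p := scaledLog_pos h.two_le h.alpha_pos (two_le_of_mem_primesLe p.2)
  lam_le_gam p := le_add_of_nonneg_right
    (scaledWeight_pos h.two_le h.alpha_pos (two_le_of_mem_primesLe p.2)).le
  gam_le_one p := scaledLog_add_scaledWeight_le h.two_le h.alpha_pos p.2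
  kap_nonneg := inv_nonneg.2 h.ubar_pos.le
  sum_le_one := by
    simp only [add_sub_cancel_left]
    rw [Finset.sum_coe_sort (primesLe y) (fun p => (ubar x y)⁻¹ * scaledWeight y α p),
      h.sum_weight, div_le_one (mul_pos h.ubar_pos h.scale_pos)]
    exact log_le_ubar_mul_saddleScale h.two_le h.le h.alpha_pos h.saddleEq
  le_sum := by
    simp only [add_sub_cancel_left]
    rw [Finset.sum_coe_sort (primesLe y) (fun p => (ubar x y)⁻¹ * scaledWeight y α p *
      (scaledLog y α p + scaledWeight y α p))]
    exact le_sum_scaledWeight_mul h.two_le h.le h.alpha_pos h.alpha_le_one h.saddleEq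
  differentiableOn_B := by
    refine DifferentiableOn.const_mul (DifferentiableOn.sub_const ?_ _) _
    exact h.differentiableOn.comp (by fun_prop) fun w hw => h.mul_mem hw
  B_zero := by rw [mul_zero, h.zero, sub_self, mul_zero]
  abs_B_le w hw := (h.near _ (h.mul_mem hw)).abs_mul_saddleScale_le h.two_le h.alpha_pos
  le_r p w hw := by
    have hm := h.mul_mem hw
    rw [scaled_r_eq h.two_le h.alpha_pos (two_le_of_mem_primesLe p.2)]
    exact (h.near _ hm).le_div h.delta_pos h.two_le h.alpha_pos (h.mem _ hm).1 p.2
  rho_nonneg := by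
    have := h.scale_pos
    rw [rhoXY]
    positivity
  two_mul_rho_sq := by
    simp only [add_sub_cancel_left]
    rw [Finset.sum_coe_sort (primesLe y) (fun p => (ubar x y)⁻¹ * scaledWeight y α p *
      ((scaledLog y α p + scaledWeight y α p) / 2 - scaledWeight y α p / 6))]
    have hU := h.ubar_pos
    have hT := h.scale_pos
    have h1 : ∀ p ∈ primesLe y, (ubar x y)⁻¹ * scaledWeight y α p *
        ((scaledLog y α p + scaledWeight y α p) / 2 - scaledWeight y α p / 6) =
        (Real.log p ^ 2 * (p : ℝ) ^ α / ((p : ℝ) ^ α - 1) ^ 2 -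
          Real.log p ^ 2 / ((p : ℝ) ^ α - 1) ^ 2 / 3) /
          (ubar x y * (2 * saddleScale y α ^ 2)) := fun p hp => by
      rw [mul_assoc, scaledWeight_mul_eq h.two_le h.alpha_pos (two_le_of_mem_primesLe hp)]
      field_simp
    rw [Finset.sum_congr rfl h1, ← Finset.sum_div, Finset.sum_sub_distrib, ← Finset.sum_div,
      div_pow, mul_pow, Real.sq_sqrt hU.le, rhoXY_sq h.alpha_pos, sigma2, sigma2t]
    field_simp
    ring
  saddle w hw := by
    simp only [add_sub_cancel_left]
    have h1 := h.saddle_scaled hw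
    have hm := h.mul_mem hw
    have hm' := h.mul_mem (SaddleCurve.neg_mem hw)
    rw [← h.sum_weight] at h1
    rw [Finset.sum_coe_sort (primesLe y) (fun p => (ubar x y)⁻¹ * scaledWeight y α p), ← h1]
    refine Eq.trans ?_ (Finset.sum_coe_sort (primesLe y) _)
    refine Finset.sum_congr rfl fun p _ => ?_
    rw [h.eulerLog_eq p.2 (h.mem _ hm).1, h.eulerLog_eq p.2 (h.mem _ hm').1,
      add_sub_add_left_eq_sub]

theorem eulerLog_eq_curve (h : IsSaddlePath c δ x y α β) (p : primesLe y) {w : ℝ}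
    (hw : w ∈ Set.Icc (-c) c) :
    eulerLog p (β (Real.sqrt (ubar x y) * w)) = eulerLog p α + h.curve.a p w :=
  h.eulerLog_eq p.2 (h.mem _ (h.mul_mem hw)).1

theorem eulerLog_sub_eq_curve (h : IsSaddlePath c δ x y α β) (p : primesLe y) {w : ℝ}
    (hw : w ∈ Set.Icc (-c) c) :
    eulerLog p (β (Real.sqrt (ubar x y) * w)) - eulerLog p (β (Real.sqrt (ubar x y) * -w)) =
      h.curve.gap p w := by
  rw [h.eulerLog_eq_curve p hw, h.eulerLog_eq_curve p (SaddleCurve.neg_mem hw),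
    add_sub_add_left_eq_sub]
  rfl

theorem curve_W (h : IsSaddlePath c δ x y α β) (p : primesLe y) :
    h.curve.W p = (ubar x y)⁻¹ * scaledWeight y α p := by
  change (ubar x y)⁻¹ * (scaledLog y α p + scaledWeight y α p - scaledLog y α p) = _
  rw [add_sub_cancel_left]

theorem curve_gam_sub_lam (h : IsSaddlePath c δ x y α β) (p : primesLe y) :
    h.curve.gam p - h.curve.lam p = scaledWeight y α p := by
  change scaledLog y α p + scaledWeight y α p - scaledLog y α p = _
  rw [add_sub_cancel_left]

theorem curve_r (h : IsSaddlePath c δ x y α β) (p : primesLe y) (w : ℝ) :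
    h.curve.r p w =
      (((p : ℕ) : ℝ) ^ β (Real.sqrt (ubar x y) * w) - 1) / (((p : ℕ) : ℝ) ^ α - 1) :=
  scaled_r_eq h.two_le h.alpha_pos (two_le_of_mem_primesLe p.2) _

theorem eulerLog'_eq_curve (h : IsSaddlePath c δ x y α β) (p : primesLe y) {w : ℝ}
    (hw : w ∈ Set.Icc (-c) c) :
    eulerLog' p (β (Real.sqrt (ubar x y) * w)) =
      saddleScale y α * (scaledWeight y α p * -(h.curve.r p w)⁻¹) := by
  rw [curve_r]
  exact eulerLog'_eq_scaled h.two_le h.alpha_pos (two_le_of_mem_primesLe p.2)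
    (h.mem _ (h.mul_mem hw)).1

theorem eulerLog''_eq_curve (h : IsSaddlePath c δ x y α β) (p : primesLe y) {w : ℝ}
    (hw : w ∈ Set.Icc (-c) c) :
    eulerLog'' p (β (Real.sqrt (ubar x y) * w)) =
      saddleScale y α ^ 2 * (scaledWeight y α p * ((h.curve.r p w)⁻¹ * (h.curve.r p w)⁻¹ *
        (h.curve.gam p * Real.exp (h.curve.lam p * h.curve.B w)))) := by
  rw [curve_r]
  exact eulerLog''_eq_scaled h.two_le h.alpha_pos (two_le_of_mem_primesLe p.2)
    (h.mem _ (h.mul_mem hw)).1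

theorem sum_eq_F20 (h : IsSaddlePath c δ x y α β) {w : ℝ} (hw : w ∈ Set.Icc (-c) c) :
    ∑ p ∈ primesLe y,
      (eulerLog'' p (β (Real.sqrt (ubar x y) * w)) *
        (1 / 2 - hOne (eulerLog p (β (Real.sqrt (ubar x y) * w)) -
          eulerLog p (β (Real.sqrt (ubar x y) * -w)))) -
        eulerLog' p (β (Real.sqrt (ubar x y) * w)) ^ 2 *
          hTwo (eulerLog p (β (Real.sqrt (ubar x y) * w)) -
          eulerLog p (β (Real.sqrt (ubar x y) * -w)))) =
      ubar x y * saddleScale y α ^ 2 * h.curve.F20 w := by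
  have hU := h.ubar_pos.ne'
  rw [SaddleCurve.F20, Finset.mul_sum, ← Finset.sum_coe_sort]
  refine Finset.sum_congr rfl fun p _ => ?_
  rw [h.eulerLog_sub_eq_curve p hw, h.eulerLog'_eq_curve p hw, h.eulerLog''_eq_curve p hw,
    h.curve_W, h.curve_gam_sub_lam]
  field_simp

theorem sum_eq_F11 (h : IsSaddlePath c δ x y α β) {w : ℝ} (hw : w ∈ Set.Icc (-c) c) :
    ∑ p ∈ primesLe y,
      eulerLog' p (β (Real.sqrt (ubar x y) * w)) * eulerLog' p (β (Real.sqrt (ubar x y) * -w)) *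
        hTwo (eulerLog p (β (Real.sqrt (ubar x y) * w)) -
          eulerLog p (β (Real.sqrt (ubar x y) * -w))) =
      ubar x y * saddleScale y α ^ 2 * h.curve.F11 w := by
  have hU := h.ubar_pos.ne'
  rw [SaddleCurve.F11, Finset.mul_sum, ← Finset.sum_coe_sort]
  refine Finset.sum_congr rfl fun p _ => ?_
  rw [h.eulerLog_sub_eq_curve p hw, h.eulerLog'_eq_curve p hw,
    h.eulerLog'_eq_curve p (SaddleCurve.neg_mem hw), h.curve_W, h.curve_gam_sub_lam]
  field_simp

theorem HessC_re (h : IsSaddlePath c δ x y α β) {w : ℝ} (hw : w ∈ Set.Icc (-c) c) :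
    (HessC y (β (Real.sqrt (ubar x y) * w) : ℂ) (β (-(Real.sqrt (ubar x y) * w)) : ℂ)).re =
      (ubar x y * saddleScale y α ^ 2) ^ 2 * h.curve.hess w := by
  have hw' := SaddleCurve.neg_mem hw
  have h2 := h.sum_eq_F20 hw'
  rw [neg_neg] at h2
  rw [← mul_neg, HessC_ofReal y (h.mem _ (h.mul_mem hw)).1 (h.mem _ (h.mul_mem hw')).1,
    Complex.ofReal_re, h.sum_eq_F20 hw, h.sum_eq_F11 hw, h2, SaddleCurve.hess]
  ring

theorem Efun_eq (h : IsSaddlePath c δ x y α β) {w : ℝ} (hw : w ∈ Set.Icc (-c) c) :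
    Efun x y α β (Real.sqrt (ubar x y) * w) =
      ∑ p ∈ primesLe y, eulerLog p α + α * Real.log x + ubar x y * h.curve.energy w := by
  have hw' := SaddleCurve.neg_mem hw
  have hU := h.ubar_pos
  have hT := h.scale_pos
  have hq := h.sqrt_pos
  have h1 : ∑ p, h.curve.W p = Real.log x / (ubar x y * saddleScale y α) := by
    rw [← h.sum_weight]
    refine Eq.trans ?_
      (Finset.sum_coe_sort (primesLe y) fun p => (ubar x y)⁻¹ * scaledWeight y α p)
    exact Finset.sum_congr rfl fun p _ => h.curve_W p
  have h2 : ∑ p ∈ primesLe y, ((eulerLog p (β (Real.sqrt (ubar x y) * w)) +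
      eulerLog p (β (Real.sqrt (ubar x y) * -w))) / 2 -
      Real.log (sinhRatio (eulerLog p (β (Real.sqrt (ubar x y) * w)) -
      eulerLog p (β (Real.sqrt (ubar x y) * -w))))) = ∑ p ∈ primesLe y, eulerLog p α +
      ubar x y * ∑ p, h.curve.kap * ((h.curve.a p w + h.curve.a p (-w)) / 2 -
        Real.log (sinhRatio (h.curve.gap p w))) := by
    rw [← Finset.sum_coe_sort, ← Finset.sum_coe_sort (primesLe y) (fun p => eulerLog p α),
      Finset.mul_sum]
    refine Eq.trans ?_ Finset.sum_add_distrib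
    refine Finset.sum_congr rfl fun p _ => ?_
    rw [h.eulerLog_sub_eq_curve p hw, h.eulerLog_eq_curve p hw, h.eulerLog_eq_curve p hw',
      show h.curve.kap = (ubar x y)⁻¹ from rfl, mul_inv_cancel_left₀ hU.ne']
    ring
  have hB : ∀ w, β (Real.sqrt (ubar x y) * w) = α + h.curve.B w / saddleScale y α := fun w => by
    rw [show h.curve.B w = saddleScale y α * (β (Real.sqrt (ubar x y) * w) - α) from rfl]
    field_simp
    ring
  rw [Efun, ← mul_neg, fy_ofReal y (h.mem _ (h.mul_mem hw)).1 (h.mem _ (h.mul_mem hw')).1,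
    Complex.ofReal_re, h2, SaddleCurve.energy, h1, hB w, hB (-w),
    show h.curve.rho = rhoXY y α / (Real.sqrt (ubar x y) * saddleScale y α) from rfl]
  have hUq : ubar x y = Real.sqrt (ubar x y) ^ 2 := (Real.sq_sqrt hU.le).symm
  generalize (∑ p, h.curve.kap * ((h.curve.a p w + h.curve.a p (-w)) / 2 -
        Real.log (sinhRatio (h.curve.gap p w)))) = S
  generalize h.curve.B w = b
  generalize h.curve.B (-w) = b'
  generalize Real.sqrt (ubar x y) = q at *
  rw [hUq]
  field_simp
  ring

theorem expansion (h : IsSaddlePath c δ x y α β) {b Cj Ck : ℕ → ℝ} {C : ℝ}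
    (h0 : b 0 = -(1 / 2)) (hb : ∀ j, |b j| ≤ Cj j)
    (hE : ∀ k, ∀ w ∈ Set.Icc (-c) c, |h.curve.energy w - h.curve.energy 0 -
      ∑ j ∈ Finset.range k, b j * w ^ (2 * j + 2)| ≤ Ck k * w ^ (2 * k + 2))
    (hH : ∀ w ∈ Set.Icc (-c) c,
      |h.curve.hess w - h.curve.hess 0| ≤ C * w ^ 2 * h.curve.hess 0) :
    ∃ b : ℕ → ℝ,
      b 0 = -(1 / 2) ∧
      (∀ j : ℕ, 1 ≤ j → |b j| ≤ Cj j / (ubar x y) ^ j) ∧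
      (∀ k : ℕ, 1 ≤ k →
        ∀ v ∈ Set.Icc (-(c * Real.sqrt (ubar x y))) (c * Real.sqrt (ubar x y)),
          |Efun x y α β v - Efun x y α β 0 -
              ∑ j ∈ Finset.range k, b j * v ^ (2 * j + 2)| ≤
            Ck k * v ^ (2 * k + 2) / (ubar x y) ^ k) ∧
      (∀ v ∈ Set.Icc (-(c * Real.sqrt (ubar x y))) (c * Real.sqrt (ubar x y)),
        |(HessC y (β v : ℂ) (β (-v) : ℂ)).re - (HessC y (α : ℂ) (α : ℂ)).re| ≤
          C * (v ^ 2 / ubar x y) * (HessC y (α : ℂ) (α : ℂ)).re) := by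
  have hU := h.ubar_pos
  have hq := h.sqrt_pos
  have hUq : Real.sqrt (ubar x y) ^ 2 = ubar x y := Real.sq_sqrt hU.le
  have hz : (0 : ℝ) ∈ Set.Icc (-c) c := ⟨by linarith [h.c_pos], h.c_pos.le⟩
  have hv : ∀ v ∈ Set.Icc (-(c * Real.sqrt (ubar x y))) (c * Real.sqrt (ubar x y)),
      ∃ w ∈ Set.Icc (-c) c, v = Real.sqrt (ubar x y) * w := fun v hv => by
    refine ⟨v / Real.sqrt (ubar x y), ⟨?_, ?_⟩, by field_simp⟩
    · rw [le_div_iff₀ hq]; linarith [hv.1]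
    · rw [div_le_iff₀ hq]; exact hv.2
  have hpow : ∀ (w : ℝ) (j : ℕ), (Real.sqrt (ubar x y) * w) ^ (2 * j + 2) =
      ubar x y ^ j * (ubar x y * w ^ (2 * j + 2)) := fun w j => by
    rw [mul_pow, show 2 * j + 2 = 2 * (j + 1) by ring, pow_mul, hUq]
    ring
  refine ⟨fun j => b j / ubar x y ^ j, by simp [h0], fun j _ => ?_, fun k _ v hvm => ?_,
    fun v hvm => ?_⟩
  · rw [abs_div, abs_of_pos (pow_pos hU j)]
    exact div_le_div_of_nonneg_right (hb j) (pow_pos hU j).le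
  · obtain ⟨w, hw, rfl⟩ := hv v hvm
    have e0 := h.Efun_eq hz
    rw [mul_zero] at e0
    have hsum : ∑ j ∈ Finset.range k, b j / ubar x y ^ j *
        (Real.sqrt (ubar x y) * w) ^ (2 * j + 2) =
        ubar x y * ∑ j ∈ Finset.range k, b j * w ^ (2 * j + 2) := by
      rw [Finset.mul_sum]
      refine Finset.sum_congr rfl fun j _ => ?_
      rw [hpow]
      field_simp
    rw [h.Efun_eq hw, e0, hsum, hpow, add_sub_add_left_eq_sub, ← mul_sub, ← mul_sub, abs_mul,
      abs_of_pos hU]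
    calc _ ≤ ubar x y * (Ck k * w ^ (2 * k + 2)) := mul_le_mul_of_nonneg_left (hE k w hw) hU.le
      _ = _ := by field_simp
  · obtain ⟨w, hw, rfl⟩ := hv v hvm
    have e0 := h.HessC_re hz
    rw [mul_zero, neg_zero, h.zero] at e0
    rw [h.HessC_re hw, e0, ← mul_sub, abs_mul, abs_of_nonneg (sq_nonneg _),
      mul_pow (Real.sqrt (ubar x y)) w, hUq, mul_div_cancel_left₀ _ hU.ne']
    calc _ ≤ _ := mul_le_mul_of_nonneg_left (hH w hw) (sq_nonneg _)
      _ = _ := by ring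

end IsSaddlePath

theorem isSaddlePath_of_mem_Ddom {c δ x y α : ℝ} {β : ℝ → ℝ} (hc : 0 < c) (hδ : 0 < δ)
    (hy : 2 ≤ y) (hxy : y ≤ x) (hα : 0 < α) (hs : saddleEq x y α)
    (hd : DifferentiableOn ℝ β
      (Set.Icc (-(c * Real.sqrt (ubar x y))) (c * Real.sqrt (ubar x y))))
    (h0 : β 0 = α)
    (hm : ∀ v ∈ Set.Icc (-(c * Real.sqrt (ubar x y))) (c * Real.sqrt (ubar x y)),
      0 < β v ∧ β v ≤ 1)
    (h : ∀ v ∈ Set.Icc (0 : ℝ) (c * Real.sqrt (ubar x y)),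
      (β v, β (-v)) ∈ Ddom δ α y ∧
      pdv 1 0 (fy y) (β v : ℂ) (β (-v) : ℂ) =
        ((v * rhoXY y α - Real.log x / 2 : ℝ) : ℂ) ∧
      pdv 0 1 (fy y) (β v : ℂ) (β (-v) : ℂ) =
        ((-(v * rhoXY y α) - Real.log x / 2 : ℝ) : ℂ)) :
    IsSaddlePath c δ x y α β := by
  refine ⟨hc, hδ, hy, hxy, hα, hs, hd, h0, hm, fun v hv => ?_, fun v hv => ?_⟩
  · rcases le_total 0 v with hv0 | hv0
    · exact (nearSaddle_of_mem_Ddom hδ hy (h v ⟨hv0, hv.2⟩).1).1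
    · have := (nearSaddle_of_mem_Ddom hδ hy (h (-v) ⟨by linarith, by linarith [hv.1]⟩).1).2
      rwa [neg_neg] at this
  · have p1 := (hm v hv).1
    have p2 := (hm (-v) (SaddleCurve.neg_mem hv)).1
    rcases le_total 0 v with hv0 | hv0
    · have h1 := (h v ⟨hv0, hv.2⟩).2.1
      rw [pdv_one_zero_ofReal y p1 p2] at h1
      exact_mod_cast h1
    · have h1 := (h (-v) ⟨by linarith, by linarith [hv.1]⟩).2.2
      rw [neg_neg, pdv_zero_one_ofReal y p2 p1, Complex.ofReal_inj] at h1
      rw [neg_mul, neg_neg] at h1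
      rw [← h1]
      refine Finset.sum_congr rfl fun p _ => ?_
      rw [← neg_sub (eulerLog p (β v)), hOne_neg, ← sub_eq_add_neg]

/-- Lemma 7. -/
theorem stmt18 :
    ∀ δ₀ c₆ : ℝ, 0 < δ₀ → 0 < c₆ →
      ∃ Cj : ℕ → ℝ, ∃ Ck : ℕ → ℝ, ∃ C : ℝ,
        (∀ j : ℕ, 0 < Cj j) ∧ (∀ k : ℕ, 0 < Ck k) ∧ 0 < C ∧
        ∀ x y α : ℝ, ∀ β : ℝ → ℝ,
          2 ≤ y → y ≤ x → 0 < α → saddleEq x y α →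
          DifferentiableOn ℝ β
            (Set.Icc (-(c₆ * Real.sqrt (ubar x y))) (c₆ * Real.sqrt (ubar x y))) →
          β 0 = α →
          (∀ v ∈ Set.Icc (-(c₆ * Real.sqrt (ubar x y))) (c₆ * Real.sqrt (ubar x y)),
            0 < β v ∧ β v ≤ 1) →
          (∀ v ∈ Set.Icc (0 : ℝ) (c₆ * Real.sqrt (ubar x y)),
            (β v, β (-v)) ∈ Ddom δ₀ α y ∧
            pdv 1 0 (fy y) (β v : ℂ) (β (-v) : ℂ) =
              ((v * rhoXY y α - Real.log x / 2 : ℝ) : ℂ) ∧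
            pdv 0 1 (fy y) (β v : ℂ) (β (-v) : ℂ) =
              ((-(v * rhoXY y α) - Real.log x / 2 : ℝ) : ℂ)) →
          ∃ b : ℕ → ℝ,
            b 0 = -(1 / 2) ∧
            (∀ j : ℕ, 1 ≤ j → |b j| ≤ Cj j / (ubar x y) ^ j) ∧
            (∀ k : ℕ, 1 ≤ k →
              ∀ v ∈ Set.Icc (-(c₆ * Real.sqrt (ubar x y))) (c₆ * Real.sqrt (ubar x y)),
                |Efun x y α β v - Efun x y α β 0 -
                    ∑ j ∈ Finset.range k, b j * v ^ (2 * j + 2)| ≤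
                  Ck k * v ^ (2 * k + 2) / (ubar x y) ^ k) ∧
            (∀ v ∈ Set.Icc (-(c₆ * Real.sqrt (ubar x y))) (c₆ * Real.sqrt (ubar x y)),
              |(HessC y (β v : ℂ) (β (-v) : ℂ)).re - (HessC y (α : ℂ) (α : ℂ)).re| ≤
                C * (v ^ 2 / ubar x y) * (HessC y (α : ℂ) (α : ℂ)).re) := by
  intro δ₀ c₆ hδ hc
  obtain ⟨Cj, Ck, C, hCj, hCk, hC, hexp⟩ := SaddleCurve.exists_expansion (c := c₆)
    (M := δ₀ + 2 * (1 + δ₀)) (η := 1 / (Real.exp δ₀ * (1 + 2 * (1 + δ₀)))) (c₀ := 1 / 384) hc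
    (by positivity) (by norm_num)
  refine ⟨Cj, Ck, C, hCj, hCk, hC, fun x y α β hy hxy hα hs hd h0 hm h => ?_⟩
  have hpath := isSaddlePath_of_mem_Ddom hc hδ hy hxy hα hs hd h0 hm h
  obtain ⟨b, hb0, hb, hE, hH⟩ := hexp hpath.curve
  exact hpath.expansion hb0 hb hE hH

end
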